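/- Let 𝒳,𝒴,𝒵 be finite alphabets and p_{XYZ} a PMF on 𝒳×𝒴×𝒵. A pair (R,C) of nonnegative reals belongs to ℛ_s(p_{XYZ}) if and only if there exist a finite set 𝒲 with |𝒲| ≤ (|𝒳||𝒴||𝒵|)² and a PMF p_{WXYZ} on 𝒲×𝒳×𝒴×𝒵 such that: (i) its 𝒳×𝒴×𝒵-marginal equals p_{XYZ}; (ii) Z−X−W and X−(Z,W)−Y are Markov chains; and (iii) R ≥ I(X;W) − I(W;Z) and R + C ≥ I(X,Y,Z;W) − I(W;Z), where the mutual informations are computed under p_{WXYZ}. -/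

import Mathlib

open scoped BigOperators Classical

noncomputable section

/-- A probability mass function on a finite type, represented as a real-valued function. -/
def IsPMF {α : Type*} [Fintype α] (p : α → ℝ) : Prop :=
  (∀ a, 0 ≤ p a) ∧ ∑ a, p a = 1

/-- Pushforward (marginal/image distribution) of `p` along `f`. -/
def push {α β : Type*} [Fintype α] (p : α → ℝ) (f : α → β) : β → ℝ :=
  fun b => ∑ a, if f a = b then p a else 0

/-- Shannon entropy (base 2) of a PMF, with the convention `0 * log 0 = 0`. -/
def Hent {α : Type*} [Fintype α] (p : α → ℝ) : ℝ :=
  ∑ a, -(p a * Real.logb 2 (p a))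

/-- Mutual information `I(A;B)` of a joint PMF on `α × β`. -/
def I2 {α β : Type*} [Fintype α] [Fintype β] (p : α × β → ℝ) : ℝ :=
  Hent (push p Prod.fst) + Hent (push p Prod.snd) - Hent p

/-- Conditional mutual information `I(A;B|C)` of a joint PMF on `α × β × γ`,
computed as `H(A,C) + H(B,C) - H(A,B,C) - H(C)`. -/
def CI {α β γ : Type*} [Fintype α] [Fintype β] [Fintype γ]
    (p : α × β × γ → ℝ) : ℝ :=
  Hent (push p (fun x => (x.1, x.2.2))) + Hent (push p Prod.snd)
    - Hent p - Hent (push p (fun x => x.2.2))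

/-- Markov chain `A − B − C` for a joint PMF on `α × β × γ`:
`A` and `C` are conditionally independent given `B`, i.e.
`p(a,b,c) p(b) = p(a,b) p(b,c)` for all `a, b, c`. -/
def Markov {α β γ : Type*} [Fintype α] [Fintype β] [Fintype γ]
    (p : α × β × γ → ℝ) : Prop :=
  ∀ a b c, p (a, b, c) * push p (fun x => x.2.1) b
    = push p (fun x => (x.1, x.2.1)) (a, b) * push p Prod.snd (b, c)

/-- Total variation distance `‖p − q‖₁ = (1/2) Σ |p a − q a|`. -/
def tvDist {α : Type*} [Fintype α] (p q : α → ℝ) : ℝ :=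
  (1 / 2) * ∑ a, |p a - q a|

/-- `⌈2^{nC}⌉`. -/
def NC (n : ℕ) (C : ℝ) : ℕ := ⌈(2 : ℝ) ^ ((n : ℝ) * C)⌉₊

/-- `(R,C)` is achievable for the channel-synthesis-with-side-information problem
for the PMF `p` on `𝒳 × 𝒴 × 𝒵` (Definition 1 of the paper): for every `ε > 0` and all
sufficiently large `n` there are a message alphabet `[Θ]` of rate at most `R + ε`,
`⌈2^{nC}⌉` randomized encoders `𝒳^n → [Θ]` and randomized decoders `𝒵^n × [Θ] → 𝒴^n`
whose induced joint PMF is `ε`-close in total variation to the `n`-fold product of `p`. -/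
def RsAchievable {X Y Z : Type} [Fintype X] [Fintype Y] [Fintype Z]
    (p : X × Y × Z → ℝ) (R C : ℝ) : Prop :=
  ∀ ε : ℝ, 0 < ε → ∃ N : ℕ, ∀ n : ℕ, N ≤ n →
    ∃ Θ : ℕ,
      (1 / (n : ℝ)) * Real.logb 2 (Θ : ℝ) ≤ R + ε ∧
      ∃ enc : Fin (NC n C) → (Fin n → X) → Fin Θ → ℝ,
        ∃ dec : Fin (NC n C) → (Fin n → Z) → Fin Θ → (Fin n → Y) → ℝ,
          (∀ μ xn, IsPMF (enc μ xn)) ∧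
          (∀ μ zn m, IsPMF (dec μ zn m)) ∧
          tvDist
            (fun w : (Fin n → X) × (Fin n → Y) × (Fin n → Z) =>
              ∏ i, p (w.1 i, w.2.1 i, w.2.2 i))
            (fun w : (Fin n → X) × (Fin n → Y) × (Fin n → Z) =>
              (NC n C : ℝ)⁻¹ * ∑ μ : Fin (NC n C), ∑ m : Fin Θ,
                (∏ i, push p (fun v => (v.1, v.2.2)) (w.1 i, w.2.2 i)) *
                  enc μ w.1 m * dec μ w.2.2 m w.2.1) ≤ ε

section Pushforward

variable {α β γ : Type*} [Fintype α] [Fintype β] [Fintype γ]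

lemma sum_push_mul (p : α → ℝ) (f : α → β) (g : β → ℝ) :
    ∑ b, push p f b * g b = ∑ a, p a * g (f a) := by
  simp only [push, Finset.sum_mul]
  rw [Finset.sum_comm]
  refine Finset.sum_congr rfl fun a _ => ?_
  rw [Finset.sum_eq_single (f a)]
  · simp
  · intro b _ hb
    rw [if_neg (Ne.symm hb), zero_mul]
  · simp

lemma sum_push (p : α → ℝ) (f : α → β) : ∑ b, push p f b = ∑ a, p a := by
  simpa using sum_push_mul p f (fun _ => 1)

lemma push_push {δ : Type*} (p : α → ℝ) (f : α → β) (g : β → δ) :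
    push (push p f) g = push p (fun a => g (f a)) := by
  funext c
  have := sum_push_mul p f (fun b => if g b = c then 1 else 0)
  simpa [push] using this

lemma push_nonneg {δ : Type*} {p : α → ℝ} (hp : ∀ a, 0 ≤ p a) (f : α → δ) (b : δ) :
    0 ≤ push p f b :=
  Finset.sum_nonneg fun a _ => by split_ifs <;> simp [hp a]

lemma IsPMF.push {p : α → ℝ} (hp : IsPMF p) (f : α → β) : IsPMF (push p f) :=
  ⟨push_nonneg hp.1 f, by rw [sum_push, hp.2]⟩

lemma le_push {δ : Type*} {p : α → ℝ} (hp : ∀ a, 0 ≤ p a) (f : α → δ) (a : α) :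
    p a ≤ push p f (f a) := by
  have := Finset.single_le_sum (f := fun a' => if f a' = f a then p a' else 0)
    (fun a' _ => by split_ifs <;> simp [hp a']) (Finset.mem_univ a)
  simpa [push] using this

lemma push_le_push_comp {δ ε : Type*} {p : α → ℝ} (hp : ∀ a, 0 ≤ p a) (f : α → δ) (g : δ → ε)
    (b : δ) : push p f b ≤ push p (fun a => g (f a)) (g b) := by
  refine Finset.sum_le_sum fun a _ => ?_
  by_cases h : f a = b
  · simp [h]
  · rw [if_neg h]
    split_ifs <;> simp [hp a]

lemma push_fst (p : α × β → ℝ) (a : α) : push p Prod.fst a = ∑ b, p (a, b) := by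
  rw [push, Fintype.sum_prod_type, Finset.sum_eq_single a]
  · simp
  · intro a' _ h
    simp [h]
  · simp

lemma push_snd (p : α × β → ℝ) (b : β) : push p Prod.snd b = ∑ a, p (a, b) := by
  rw [push, Fintype.sum_prod_type]
  refine Finset.sum_congr rfl fun a _ => ?_
  rw [Finset.sum_eq_single b]
  · simp
  · intro a' _ h
    simp [h]
  · simp

lemma push_injective {δ : Type*} (p : α → ℝ) {f : α → δ} (hf : Function.Injective f) (a : α) :
    push p f (f a) = p a := by
  rw [push, Finset.sum_eq_single a]
  · simp
  · intro a' _ h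
    rw [if_neg (fun h' => h (hf h'))]
  · simp

lemma sum_abs_push_sub_le (p q : α → ℝ) (f : α → β) :
    ∑ b, |push p f b - push q f b| ≤ ∑ a, |p a - q a| := by
  rw [← sum_push (fun a => |p a - q a|) f]
  refine Finset.sum_le_sum fun b _ => ?_
  simp only [push, ← Finset.sum_sub_distrib]
  refine (Finset.abs_sum_le_sum_abs _ _).trans (Finset.sum_le_sum fun a _ => ?_)
  split_ifs <;> simp

end Pushforward

section IidExpectation

variable {J A : Type*} [Fintype J] [DecidableEq J] [Fintype A]

/-- Expectation of `F` under the product distribution on `J → A` with marginals `r`. -/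
def iidExp (r : A → ℝ) (F : (J → A) → ℝ) : ℝ :=
  ∑ c, (∏ j, r (c j)) * F c

lemma sum_prod_eq_prod_sum (f : J → A → ℝ) :
    ∑ c : J → A, ∏ j, f j (c j) = ∏ j, ∑ a, f j a :=
  (Fintype.prod_sum f).symm

lemma prod_isPMF {r : A → ℝ} (hr : IsPMF r) : IsPMF (fun c : J → A => ∏ j, r (c j)) :=
  ⟨fun c => Finset.prod_nonneg fun _ _ => hr.1 _, by
    rw [sum_prod_eq_prod_sum (fun _ => r)]
    simp [hr.2]⟩

lemma iidExp_mono {r : A → ℝ} (hr : IsPMF r) {F G : (J → A) → ℝ} (h : ∀ c, F c ≤ G c) :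
    iidExp r F ≤ iidExp r G :=
  Finset.sum_le_sum fun c _ =>
    mul_le_mul_of_nonneg_left (h c) (Finset.prod_nonneg fun _ _ => hr.1 _)

lemma iidExp_const {r : A → ℝ} (hr : IsPMF r) (x : ℝ) :
    iidExp r (fun _ : J → A => x) = x := by
  rw [iidExp, ← Finset.sum_mul, (prod_isPMF hr).2, one_mul]

lemma iidExp_add (r : A → ℝ) (F G : (J → A) → ℝ) :
    iidExp r (fun c => F c + G c) = iidExp r F + iidExp r G := by
  simp [iidExp, mul_add, Finset.sum_add_distrib]

lemma iidExp_const_mul (r : A → ℝ) (x : ℝ) (F : (J → A) → ℝ) :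
    iidExp r (fun c => x * F c) = x * iidExp r F := by
  simp only [iidExp, Finset.mul_sum]
  exact Finset.sum_congr rfl fun c _ => by ring

lemma iidExp_sum {ι : Type*} (s : Finset ι) (r : A → ℝ) (F : ι → (J → A) → ℝ) :
    iidExp r (fun c => ∑ i ∈ s, F i c) = ∑ i ∈ s, iidExp r (F i) := by
  simp only [iidExp, Finset.mul_sum]
  exact Finset.sum_comm

lemma exists_le_of_iidExp_le {r : A → ℝ} (hr : IsPMF r) {F : (J → A) → ℝ} {x : ℝ}
    (h : iidExp r F ≤ x) : ∃ c, F c ≤ x := by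
  by_contra! hc
  have h1 : iidExp r (fun _ : J → A => x) < iidExp r F := by
    obtain ⟨c, hc0⟩ : ∃ c : J → A, ∏ j, r (c j) ≠ 0 := by
      by_contra! h0
      have := (prod_isPMF (J := J) hr).2
      simp [h0] at this
    refine Finset.sum_lt_sum (fun c _ => mul_le_mul_of_nonneg_left (hc c).le
      ((prod_isPMF hr).1 c)) ⟨c, Finset.mem_univ _, ?_⟩
    exact mul_lt_mul_of_pos_left (hc c) (lt_of_le_of_ne ((prod_isPMF hr).1 c) (Ne.symm hc0))
  rw [iidExp_const hr] at h1
  linarith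

lemma iidExp_eval {r : A → ℝ} (hr : IsPMF r) (i : J) (g : A → ℝ) :
    iidExp r (fun c : J → A => g (c i)) = ∑ a, r a * g a := by
  have h : ∀ c : J → A, (∏ j, r (c j)) * g (c i)
      = ∏ j, r (c j) * (if j = i then g (c j) else 1) := by
    intro c
    rw [Finset.prod_mul_distrib]
    simp
  simp only [iidExp, h]
  rw [sum_prod_eq_prod_sum (fun j a => r a * (if j = i then g a else 1)),
    Finset.prod_eq_single i]
  · simp
  · intro j _ hj
    simp [hj, hr.2]
  · simp

lemma iidExp_eval_mul_eval {r : A → ℝ} (hr : IsPMF r) {i k : J} (hik : i ≠ k) (g h : A → ℝ) :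
    iidExp r (fun c : J → A => g (c i) * h (c k))
      = (∑ a, r a * g a) * ∑ a, r a * h a := by
  have e : ∀ c : J → A, (∏ j, r (c j)) * (g (c i) * h (c k))
      = ∏ j, r (c j) * ((if j = i then g (c j) else 1) * (if j = k then h (c j) else 1)) := by
    intro c
    rw [Finset.prod_mul_distrib, Finset.prod_mul_distrib]
    simp
  simp only [iidExp, e]
  rw [sum_prod_eq_prod_sum
      (fun j a => r a * ((if j = i then g a else 1) * (if j = k then h a else 1))),
    Finset.prod_eq_mul i k hik]
  · simp [hik, hik.symm]
  · rintro j _ ⟨hj1, hj2⟩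
    simp [hj1, hj2, hr.2]
  · simp
  · simp

lemma iidExp_eval_sub_sq_eq {r : A → ℝ} (hr : IsPMF r) (S : Finset J) (g : A → ℝ)
    (hg : ∑ a, r a * g a = 0) :
    iidExp r (fun c : J → A => (∑ j ∈ S, g (c j)) ^ 2) = S.card * ∑ a, r a * g a ^ 2 := by
  simp only [pow_two, Finset.sum_mul_sum]
  rw [iidExp_sum, Finset.sum_congr rfl (fun i hi => ?_), Finset.sum_const, nsmul_eq_mul]
  rw [iidExp_sum, Finset.sum_eq_single i]
  · exact iidExp_eval hr i (fun a => g a * g a)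
  · intro k _ hk
    rw [iidExp_eval_mul_eval hr hk.symm, hg, zero_mul]
  · exact fun h => absurd hi h

lemma iidExp_abs_le_sqrt {r : A → ℝ} (hr : IsPMF r) (F : (J → A) → ℝ) :
    iidExp r (fun c => |F c|) ≤ √(iidExp r (fun c => F c ^ 2)) := by
  refine Real.le_sqrt_of_sq_le ?_
  have h := Finset.sum_sq_le_sum_mul_sum_of_sq_le_mul (Finset.univ : Finset (J → A))
    (r := fun c => (∏ j, r (c j)) * |F c|) (f := fun c => ∏ j, r (c j))
    (g := fun c => (∏ j, r (c j)) * F c ^ 2) (fun c _ => (prod_isPMF hr).1 c)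
    (fun c _ => mul_nonneg ((prod_isPMF hr).1 c) (sq_nonneg _))
    (fun c _ => by rw [mul_pow, sq_abs]; exact le_of_eq (by ring))
  rw [(prod_isPMF hr).2, one_mul] at h
  exact h

/-- Mean absolute deviation of an empirical average of i.i.d. nonnegative variables. -/
lemma iidExp_abs_average_sub_le {r : A → ℝ} (hr : IsPMF r) (S : Finset J) (hS : S.Nonempty)
    (g : A → ℝ) :
    iidExp r (fun c : J → A => |(S.card : ℝ)⁻¹ * ∑ j ∈ S, g (c j) - ∑ a, r a * g a|)
      ≤ √((∑ a, r a * g a ^ 2) / S.card) := by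
  refine (iidExp_abs_le_sqrt hr _).trans (Real.sqrt_le_sqrt ?_)
  set m := ∑ a, r a * g a with hm
  have hc : (0 : ℝ) < S.card := by exact_mod_cast hS.card_pos
  have h0 : ∑ a, r a * (g a - m) = 0 := by
    simp only [mul_sub, Finset.sum_sub_distrib, ← Finset.sum_mul, hr.2]
    simp [hm]
  have e : ∀ c : J → A, ((S.card : ℝ)⁻¹ * ∑ j ∈ S, g (c j) - m) ^ 2
      = ((S.card : ℝ)⁻¹) ^ 2 * (∑ j ∈ S, (g (c j) - m)) ^ 2 := by
    intro c
    rw [Finset.sum_sub_distrib, Finset.sum_const, nsmul_eq_mul, ← mul_pow]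
    congr 1
    field_simp
  simp only [e]
  rw [iidExp_const_mul, iidExp_eval_sub_sq_eq hr S (fun a => g a - m) h0]
  have h2 : ∑ a, r a * (g a - m) ^ 2 ≤ ∑ a, r a * g a ^ 2 := by
    have : ∑ a, r a * (g a - m) ^ 2 = ∑ a, r a * g a ^ 2 - m ^ 2 := by
      have e2 : ∀ a, r a * (g a - m) ^ 2 = r a * g a ^ 2 - 2 * m * (r a * g a) + r a * m ^ 2 := by
        intro a; ring
      simp only [e2, Finset.sum_add_distrib, Finset.sum_sub_distrib, ← Finset.mul_sum,
        ← Finset.sum_mul, hr.2, ← hm]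
      ring
    rw [this]
    nlinarith [sq_nonneg m]
  calc ((S.card : ℝ)⁻¹) ^ 2 * (S.card * ∑ a, r a * (g a - m) ^ 2)
      = (∑ a, r a * (g a - m) ^ 2) / S.card := by field_simp
    _ ≤ _ := by gcongr

/-- Weak law of large numbers, in the form of Chebyshev's inequality. -/
lemma sum_prod_large_deviation_le {r : A → ℝ} (hr : IsPMF r) (f : A → ℝ) {n : ℕ} (hn : 0 < n)
    {δ : ℝ} (hδ : 0 < δ) :
    (∑ c : Fin n → A, if n * δ ≤ |∑ i, f (c i) - n * ∑ a, r a * f a|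
      then ∏ i, r (c i) else 0) ≤ (∑ a, r a * (f a - ∑ b, r b * f b) ^ 2) / (n * δ ^ 2) := by
  set m := ∑ a, r a * f a with hm
  have h0 : ∑ a, r a * (f a - m) = 0 := by
    simp only [mul_sub, Finset.sum_sub_distrib, ← Finset.sum_mul, hr.2]
    simp [hm]
  have hn' : (0 : ℝ) < n := by exact_mod_cast hn
  have key := iidExp_eval_sub_sq_eq hr (Finset.univ : Finset (Fin n)) (fun a => f a - m) h0
  rw [le_div_iff₀ (by positivity)]
  have h1 : (∑ c : Fin n → A, if n * δ ≤ |∑ i, f (c i) - n * m|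
      then ∏ i, r (c i) else 0) * (n * δ) ^ 2
      ≤ iidExp r (fun c : Fin n → A => (∑ i, (f (c i) - m)) ^ 2) := by
    rw [iidExp, Finset.sum_mul]
    apply Finset.sum_le_sum
    intro c _
    have hc := (prod_isPMF (J := Fin n) hr).1 c
    dsimp only at hc
    split_ifs with h
    · refine mul_le_mul_of_nonneg_left ?_ hc
      rw [Finset.sum_sub_distrib, Finset.sum_const, Finset.card_univ, Fintype.card_fin,
        nsmul_eq_mul, ← sq_abs (∑ i, f (c i) - n * m)]
      exact pow_le_pow_left₀ (by positivity) h 2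
    · rw [zero_mul]
      positivity
  rw [key, Finset.card_univ, Fintype.card_fin] at h1
  have h3 : (n : ℝ) * ((∑ c : Fin n → A, if n * δ ≤ |∑ i, f (c i) - n * m|
      then ∏ i, r (c i) else 0) * (n * δ ^ 2)) ≤ n * ∑ a, r a * (f a - m) ^ 2 := by
    calc _ = (∑ c : Fin n → A, if n * δ ≤ |∑ i, f (c i) - n * m|
      then ∏ i, r (c i) else 0) * (n * δ) ^ 2 := by ring
      _ ≤ _ := h1
  exact le_of_mul_le_mul_left h3 hn'

end IidExpectation

section OneShotBounds

set_option linter.unusedSectionVars false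

variable {J W A : Type*} [Fintype J] [DecidableEq J] [Fintype W] [Fintype A]

/-- Output distribution of the channel `V` with input distribution `q`. -/
def chanOut (q : W → ℝ) (V : W → A → ℝ) (a : A) : ℝ :=
  ∑ w, q w * V w a

lemma chanOut_isPMF {q : W → ℝ} (hq : IsPMF q) {V : W → A → ℝ} (hV : ∀ w, IsPMF (V w)) :
    IsPMF (chanOut q V) :=
  ⟨fun a => Finset.sum_nonneg fun w _ => mul_nonneg (hq.1 w) ((hV w).1 a), by
    simp only [chanOut]
    rw [Finset.sum_comm]
    simp [← Finset.mul_sum, (hV _).2, hq.2]⟩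

lemma iidExp_average {q : W → ℝ} (hq : IsPMF q) (S : Finset J) (hS : S.Nonempty) (g : W → ℝ) :
    iidExp q (fun c : J → W => (S.card : ℝ)⁻¹ * ∑ j ∈ S, g (c j)) = ∑ w, q w * g w := by
  have hc : (S.card : ℝ) ≠ 0 := by exact_mod_cast hS.card_pos.ne'
  rw [iidExp_const_mul, iidExp_sum, Finset.sum_congr rfl (fun i _ => iidExp_eval hq i g),
    Finset.sum_const, nsmul_eq_mul, inv_mul_cancel_left₀ hc]

/-- Soft covering: the output distribution of a random codebook is close to the target. -/
lemma iidExp_soft_covering_le {q : W → ℝ} (hq : IsPMF q) {V : W → A → ℝ}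
    (hV : ∀ w, IsPMF (V w)) (S : Finset J) (hS : S.Nonempty) {G : ℝ} (hG : 0 < G) :
    iidExp q (fun c : J → W => ∑ a, |(S.card : ℝ)⁻¹ * ∑ j ∈ S, V (c j) a - chanOut q V a|)
      ≤ √(G / S.card)
        + 2 * ∑ w, ∑ a, (if G * chanOut q V a < V w a then q w * V w a else 0) := by
  have hp := chanOut_isPMF hq hV
  have hc : (0 : ℝ) < S.card := by exact_mod_cast hS.card_pos
  have pointwise : ∀ a, iidExp q
      (fun c : J → W => |(S.card : ℝ)⁻¹ * ∑ j ∈ S, V (c j) a - chanOut q V a|)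
      ≤ chanOut q V a * √(G / S.card)
        + 2 * ∑ w, (if G * chanOut q V a < V w a then q w * V w a else 0) := by
    intro a
    set g1 : W → ℝ := fun w => if G * chanOut q V a < V w a then 0 else V w a with hg1
    set g2 : W → ℝ := fun w => if G * chanOut q V a < V w a then V w a else 0 with hg2
    have hsplit : ∀ w, V w a = g1 w + g2 w := by
      intro w
      simp only [hg1, hg2]
      split_ifs <;> simp
    have hg1nn : ∀ w, 0 ≤ g1 w := by
      intro w
      simp only [hg1]
      split_ifs
      · exact le_rfl
      · exact (hV w).1 a
    have hg2nn : ∀ w, 0 ≤ g2 w := by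
      intro w
      simp only [hg2]
      split_ifs
      · exact (hV w).1 a
      · exact le_rfl
    have hm : chanOut q V a = ∑ w, q w * g1 w + ∑ w, q w * g2 w := by
      rw [← Finset.sum_add_distrib]
      exact Finset.sum_congr rfl fun w _ => by rw [hsplit w, mul_add]
    have hm2 : 0 ≤ ∑ w, q w * g2 w :=
      Finset.sum_nonneg fun w _ => mul_nonneg (hq.1 w) (hg2nn w)
    have hbound : ∀ c : J → W, |(S.card : ℝ)⁻¹ * ∑ j ∈ S, V (c j) a - chanOut q V a|
        ≤ |(S.card : ℝ)⁻¹ * ∑ j ∈ S, g1 (c j) - ∑ w, q w * g1 w|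
          + ((S.card : ℝ)⁻¹ * ∑ j ∈ S, g2 (c j) + ∑ w, q w * g2 w) := by
      intro c
      have h2 : 0 ≤ (S.card : ℝ)⁻¹ * ∑ j ∈ S, g2 (c j) :=
        mul_nonneg (inv_nonneg.mpr hc.le) (Finset.sum_nonneg fun j _ => hg2nn _)
      have : (S.card : ℝ)⁻¹ * ∑ j ∈ S, V (c j) a - chanOut q V a
          = ((S.card : ℝ)⁻¹ * ∑ j ∈ S, g1 (c j) - ∑ w, q w * g1 w)
            + ((S.card : ℝ)⁻¹ * ∑ j ∈ S, g2 (c j) - ∑ w, q w * g2 w) := by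
        have hs : ∑ j ∈ S, V (c j) a = ∑ j ∈ S, g1 (c j) + ∑ j ∈ S, g2 (c j) := by
          rw [← Finset.sum_add_distrib]
          exact Finset.sum_congr rfl fun j _ => hsplit _
        rw [hm, hs]
        ring
      rw [this]
      refine (abs_add_le _ _).trans (add_le_add le_rfl ?_)
      rw [abs_le]
      constructor <;> linarith
    refine (iidExp_mono hq hbound).trans ?_
    rw [iidExp_add, iidExp_add, iidExp_average hq S hS, iidExp_const hq]
    have h1 := iidExp_abs_average_sub_le hq S hS g1
    have h2 : √((∑ w, q w * g1 w ^ 2) / S.card) ≤ chanOut q V a * √(G / S.card) := by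
      have hle : (∑ w, q w * g1 w ^ 2) / S.card ≤ chanOut q V a ^ 2 * (G / S.card) := by
        rw [← mul_div_assoc]
        refine div_le_div_of_nonneg_right ?_ hc.le
        calc ∑ w, q w * g1 w ^ 2 ≤ ∑ w, (G * chanOut q V a) * (q w * V w a) := by
              refine Finset.sum_le_sum fun w _ => ?_
              have h3 : g1 w ^ 2 ≤ G * chanOut q V a * V w a := by
                simp only [hg1]
                split_ifs with h
                · have := mul_nonneg (mul_nonneg hG.le (hp.1 a)) ((hV w).1 a)
                  simpa using this
                · rw [pow_two]
                  exact mul_le_mul_of_nonneg_right (not_lt.mp h) ((hV w).1 a)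
              calc q w * g1 w ^ 2 ≤ q w * (G * chanOut q V a * V w a) :=
                    mul_le_mul_of_nonneg_left h3 (hq.1 w)
                _ = _ := by ring
          _ = chanOut q V a ^ 2 * G := by
              rw [← Finset.mul_sum]
              change G * chanOut q V a * chanOut q V a = _
              ring
      refine (Real.sqrt_le_sqrt hle).trans ?_
      rw [Real.sqrt_mul (sq_nonneg _), Real.sqrt_sq (hp.1 a)]
    have h3 : ∑ w, q w * g2 w
        = ∑ w, (if G * chanOut q V a < V w a then q w * V w a else 0) := by
      refine Finset.sum_congr rfl fun w _ => ?_
      simp only [hg2]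
      split_ifs <;> simp
    rw [← h3]
    linarith
  rw [iidExp_sum]
  refine (Finset.sum_le_sum fun a _ => pointwise a).trans ?_
  rw [Finset.sum_add_distrib, ← Finset.sum_mul, hp.2, one_mul, ← Finset.mul_sum,
    Finset.sum_comm]

/-- Decoder picking some index whose codeword exceeds the likelihood threshold `τ`. -/
def thresholdDecode {L : Type*} [Nonempty L] (V : W → A → ℝ) (τ : A → ℝ) (d : L → W) (a : A) : L :=
  if h : ∃ l, τ a < V (d l) a then h.choose else Classical.arbitrary L

lemma thresholdDecode_error_le {L : Type*} [Fintype L] [DecidableEq L] [Nonempty L]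
    {V : W → A → ℝ} (hV : ∀ w, IsPMF (V w)) (τ : A → ℝ) (d : L → W) (l : L) (a : A) :
    V (d l) a * (if thresholdDecode V τ d a = l then 0 else 1)
      ≤ (if τ a < V (d l) a then 0 else V (d l) a)
        + ∑ l' ∈ Finset.univ.erase l, V (d l) a * (if τ a < V (d l') a then 1 else 0) := by
  have h0 := (hV (d l)).1 a
  have hs : ∀ l' ∈ Finset.univ.erase l,
      0 ≤ V (d l) a * (if τ a < V (d l') a then (1 : ℝ) else 0) :=
    fun l' _ => mul_nonneg h0 (by split_ifs <;> norm_num)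
  by_cases hl : τ a < V (d l) a
  · rw [if_pos hl, zero_add]
    by_cases he : thresholdDecode V τ d a = l
    · rw [if_pos he, mul_zero]
      exact Finset.sum_nonneg hs
    · rw [if_neg he]
      have hex : ∃ l, τ a < V (d l) a := ⟨l, hl⟩
      have hd : thresholdDecode V τ d a = hex.choose := by
        rw [thresholdDecode, dif_pos hex]
      have := Finset.single_le_sum hs
        (Finset.mem_erase.mpr ⟨he, Finset.mem_univ _⟩)
      refine le_trans (le_of_eq ?_) this
      rw [hd, if_pos hex.choose_spec]
  · rw [if_neg hl]
    have := Finset.sum_nonneg hs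
    have h1 : V (d l) a * (if thresholdDecode V τ d a = l then 0 else 1) ≤ V (d l) a := by
      split_ifs <;> simp [h0]
    linarith

/-- Random coding bound for the threshold decoder. -/
lemma iidExp_thresholdDecode_error_le {L : Type*} [Fintype L] [DecidableEq L] [Nonempty L]
    {q : W → ℝ} (hq : IsPMF q) {V : W → A → ℝ} (hV : ∀ w, IsPMF (V w)) {G : ℝ} (hG : 0 < G)
    {e : L → J} (he : Function.Injective e) (l : L) :
    iidExp q (fun c : J → W => ∑ a, V (c (e l)) a *
        (if thresholdDecode V (fun a => G * chanOut q V a) (fun l => c (e l)) a = l then 0 else 1))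
      ≤ (∑ w, ∑ a, if G * chanOut q V a < V w a then 0 else q w * V w a)
        + ((Fintype.card L : ℝ) - 1) / G := by
  refine (iidExp_mono hq fun c => Finset.sum_le_sum fun a _ =>
    thresholdDecode_error_le hV (fun a => G * chanOut q V a) (fun l => c (e l)) l a).trans ?_
  simp only [Finset.sum_add_distrib]
  rw [iidExp_add]
  refine add_le_add ?_ ?_
  · rw [iidExp_eval hq (e l) (fun w => ∑ a, if G * chanOut q V a < V w a then 0 else V w a)]
    refine le_of_eq (Finset.sum_congr rfl fun w _ => ?_)
    rw [Finset.mul_sum]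
    exact Finset.sum_congr rfl fun a _ => by split_ifs <;> simp
  · rw [iidExp_sum]
    simp only [iidExp_sum]
    rw [Finset.sum_comm]
    have hterm : ∀ l' ∈ Finset.univ.erase l, ∑ a, iidExp q (fun c : J → W => V (c (e l)) a *
        (if G * chanOut q V a < V (c (e l')) a then 1 else 0)) ≤ 1 / G := by
      intro l' hl'
      have hne : e l ≠ e l' := fun h => (Finset.ne_of_mem_erase hl') (he h).symm
      have : ∀ a, iidExp q (fun c : J → W => V (c (e l)) a *
          (if G * chanOut q V a < V (c (e l')) a then 1 else 0)) ≤ chanOut q V a / G := by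
        intro a
        rw [iidExp_eval_mul_eval hq hne (fun w => V w a)
          (fun w => if G * chanOut q V a < V w a then 1 else 0)]
        rw [← chanOut, Finset.mul_sum]
        have : chanOut q V a / G = ∑ w, q w * V w a / G := by
          rw [chanOut, Finset.sum_div]
        rw [this]
        refine Finset.sum_le_sum fun w _ => ?_
        rw [le_div_iff₀ hG]
        split_ifs with h
        · have := mul_le_mul_of_nonneg_left h.le (hq.1 w)
          linarith
        · have := mul_nonneg (hq.1 w) ((hV w).1 a)
          simpa using this
      refine (Finset.sum_le_sum fun a _ => this a).trans ?_
      rw [← Finset.sum_div, (chanOut_isPMF hq hV).2]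
    refine (Finset.sum_le_sum hterm).trans (le_of_eq ?_)
    rw [Finset.sum_const, Finset.card_erase_of_mem (Finset.mem_univ _), Finset.card_univ,
      nsmul_eq_mul, Nat.cast_sub Fintype.card_pos]
    push_cast
    ring

end OneShotBounds

section OneShotSynthesis

set_option linter.unusedSectionVars false

variable {K M L W X Y Z : Type*} [Fintype K] [Fintype M] [Fintype L] [Fintype W] [Fintype X]
  [Fintype Y] [Fintype Z] [DecidableEq K] [DecidableEq M] [DecidableEq L]
  [Nonempty K] [Nonempty M] [Nonempty L]

lemma sum_abs_sub_le_two {α : Type*} [Fintype α] {p q : α → ℝ} (hp : IsPMF p) (hq : IsPMF q) :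
    ∑ a, |p a - q a| ≤ 2 := by
  calc ∑ a, |p a - q a| ≤ ∑ a, (p a + q a) := Finset.sum_le_sum fun a _ => by
        rw [abs_le]
        constructor <;> linarith [hp.1 a, hq.1 a]
    _ = 2 := by rw [Finset.sum_add_distrib, hp.2, hq.2]; norm_num

/-- The likelihood encoder associated with a list `d` of codewords. -/
def likelihoodEnc {I : Type*} [Fintype I] (V : W → X → ℝ) (d : I → W) (x : X) (i : I) : ℝ :=
  if ∑ i, V (d i) x = 0 then (Fintype.card I : ℝ)⁻¹ else V (d i) x / ∑ i, V (d i) x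

lemma likelihoodEnc_isPMF {I : Type*} [Fintype I] [Nonempty I] {V : W → X → ℝ}
    (hV : ∀ w, IsPMF (V w)) (d : I → W) (x : X) : IsPMF (likelihoodEnc V d x) := by
  constructor
  · intro i
    rw [likelihoodEnc]
    split_ifs
    · positivity
    · exact div_nonneg ((hV _).1 x) (Finset.sum_nonneg fun i _ => (hV _).1 x)
  · simp only [likelihoodEnc]
    split_ifs with h
    · simp
    · rw [← Finset.sum_div, div_self h]

lemma sum_mul_likelihoodEnc {I : Type*} [Fintype I] {V : W → X → ℝ}
    (hV : ∀ w, IsPMF (V w)) (d : I → W) (x : X) (i : I) :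
    (∑ i, V (d i) x) * likelihoodEnc V d x i = V (d i) x := by
  rw [likelihoodEnc]
  split_ifs with h
  · rw [h, zero_mul]
    rw [Finset.sum_eq_zero_iff_of_nonneg fun i _ => (hV _).1 x] at h
    exact (h i (Finset.mem_univ i)).symm
  · field_simp

/-- The joint channel from the auxiliary variable to `(x, y, z)`. -/
def jointChan (V : W → X → ℝ) (T : X → Z → ℝ) (U : Z → W → Y → ℝ) (w : W) (v : X × Y × Z) : ℝ :=
  V w v.1 * T v.1 v.2.2 * U v.2.2 w v.2.1

lemma jointChan_isPMF {V : W → X → ℝ} (hV : ∀ w, IsPMF (V w)) {T : X → Z → ℝ}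
    (hT : ∀ x, IsPMF (T x)) {U : Z → W → Y → ℝ} (hU : ∀ z w, IsPMF (U z w)) (w : W) :
    IsPMF (jointChan V T U w) := by
  refine ⟨fun v => mul_nonneg (mul_nonneg ((hV _).1 _) ((hT _).1 _)) ((hU _ _).1 _), ?_⟩
  simp only [jointChan, Fintype.sum_prod_type]
  rw [← (hV w).2]
  refine Finset.sum_congr rfl fun x _ => ?_
  rw [Finset.sum_comm]
  simp only [← Finset.mul_sum, (hU _ _).2, (hT _).2, mul_one]

/-- For a fixed codebook, the likelihood encoder and threshold decoder synthesize the target up to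
two soft-covering errors and a decoding error. -/
lemma exists_enc_dec_of_codebook {q : W → ℝ} {V : W → X → ℝ} (hV : ∀ w, IsPMF (V w))
    {T : X → Z → ℝ} (hT : ∀ x, IsPMF (T x)) {U : Z → W → Y → ℝ} (hU : ∀ z w, IsPMF (U z w))
    (τ : Z → ℝ) (c : K × M × L → W) :
    ∃ enc : K → X → M → ℝ, ∃ dec : K → Z → M → Y → ℝ,
      (∀ k x, IsPMF (enc k x)) ∧ (∀ k z m, IsPMF (dec k z m)) ∧
      ∑ v : X × Y × Z, |chanOut q (jointChan V T U) v
          - (Fintype.card K : ℝ)⁻¹ * ∑ k, ∑ m,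
            (chanOut q V v.1 * T v.1 v.2.2) * enc k v.1 m * dec k v.2.2 m v.2.1|
        ≤ (∑ v, |(Fintype.card (K × M × L) : ℝ)⁻¹ * ∑ j, jointChan V T U (c j) v
              - chanOut q (jointChan V T U) v|)
          + 2 * ((Fintype.card (K × M × L) : ℝ)⁻¹ * ∑ j : K × M × L, ∑ z, chanOut (V (c j)) T z *
              (if thresholdDecode (fun w => chanOut (V w) T) τ (fun l => c (j.1, j.2.1, l)) z
                = j.2.2 then 0 else 1))
          + (Fintype.card K : ℝ)⁻¹ * ∑ k, ∑ x, |(Fintype.card (M × L) : ℝ)⁻¹ *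
              ∑ i, V (c (k, i)) x - chanOut q V x| := by
  set N : ℝ := (Fintype.card (K × M × L) : ℝ)⁻¹ with hN
  have hN0 : 0 ≤ N := by positivity
  have hNK : N = (Fintype.card K : ℝ)⁻¹ * (Fintype.card (M × L) : ℝ)⁻¹ := by
    rw [hN, Fintype.card_prod K, Nat.cast_mul, mul_inv]
  set lh : K → Z → M → L := fun k z m =>
    thresholdDecode (fun w => chanOut (V w) T) τ (fun l => c (k, m, l)) z with hlh
  set e : K → X → M × L → ℝ := fun k => likelihoodEnc V (fun i => c (k, i)) with he
  have hepmf : ∀ k x, IsPMF (e k x) := fun k x => likelihoodEnc_isPMF hV _ x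
  refine ⟨fun k x m => ∑ l, e k x (m, l), fun k z m => U z (c (k, m, lh k z m)), ?_, ?_, ?_⟩
  · exact fun k x => ⟨fun m => Finset.sum_nonneg fun l _ => (hepmf k x).1 _, by
      rw [← Fintype.sum_prod_type]; exact (hepmf k x).2⟩
  · exact fun k z m => hU _ _
  set P2 : X × Y × Z → ℝ := fun v => N * ∑ j : K × M × L,
    V (c j) v.1 * T v.1 v.2.2 * U v.2.2 (c (j.1, j.2.1, lh j.1 v.2.2 j.2.1)) v.2.1 with hP2
  have hdec : ∑ v, |N * ∑ j, jointChan V T U (c j) v - P2 v|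
      ≤ 2 * (N * ∑ j : K × M × L, ∑ z, chanOut (V (c j)) T z *
          (if lh j.1 z j.2.1 = j.2.2 then 0 else 1)) := by
    have h1 : ∀ v, |N * ∑ j, jointChan V T U (c j) v - P2 v|
        ≤ ∑ j : K × M × L, N * (V (c j) v.1 * T v.1 v.2.2 *
          |U v.2.2 (c j) v.2.1 - U v.2.2 (c (j.1, j.2.1, lh j.1 v.2.2 j.2.1)) v.2.1|) := by
      intro v
      rw [hP2, ← mul_sub, abs_mul, abs_of_nonneg hN0, ← Finset.sum_sub_distrib, ← Finset.mul_sum]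
      refine mul_le_mul_of_nonneg_left ?_ hN0
      refine (Finset.abs_sum_le_sum_abs _ _).trans (Finset.sum_le_sum fun j _ => ?_)
      rw [jointChan, ← mul_sub, abs_mul,
        abs_of_nonneg (mul_nonneg ((hV _).1 _) ((hT _).1 _))]
    refine (Finset.sum_le_sum fun v _ => h1 v).trans ?_
    rw [Finset.sum_comm, mul_left_comm, Finset.mul_sum (a := (2 : ℝ)), Finset.mul_sum]
    refine Finset.sum_le_sum fun j _ => ?_
    rw [← Finset.mul_sum]
    refine mul_le_mul_of_nonneg_left ?_ hN0
    have h2 : ∑ v : X × Y × Z, V (c j) v.1 * T v.1 v.2.2 *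
          |U v.2.2 (c j) v.2.1 - U v.2.2 (c (j.1, j.2.1, lh j.1 v.2.2 j.2.1)) v.2.1|
        = ∑ z, ∑ x, V (c j) x * T x z *
          ∑ y, |U z (c j) y - U z (c (j.1, j.2.1, lh j.1 z j.2.1)) y| := by
      rw [Fintype.sum_prod_type, Finset.sum_comm, Fintype.sum_prod_type, Finset.sum_comm]
      refine Finset.sum_congr rfl fun z _ => ?_
      rw [Finset.sum_comm]
      simp only [Finset.mul_sum]
    rw [h2, Finset.mul_sum]
    refine Finset.sum_le_sum fun z _ => ?_
    rw [chanOut, ← Finset.sum_mul, mul_left_comm]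
    refine mul_le_mul_of_nonneg_left ?_
      (Finset.sum_nonneg fun x _ => mul_nonneg ((hV _).1 _) ((hT _).1 _))
    split_ifs with h
    · rw [h]
      simp
    · rw [mul_one]
      exact sum_abs_sub_le_two (hU _ _) (hU _ _)
  have henc : ∑ v : X × Y × Z, |P2 v - (Fintype.card K : ℝ)⁻¹ * ∑ k, ∑ m,
        (chanOut q V v.1 * T v.1 v.2.2) * (∑ l, e k v.1 (m, l)) *
          U v.2.2 (c (k, m, lh k v.2.2 m)) v.2.1|
      ≤ (Fintype.card K : ℝ)⁻¹ * ∑ k, ∑ x, |(Fintype.card (M × L) : ℝ)⁻¹ *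
              ∑ i, V (c (k, i)) x - chanOut q V x| := by
    have hK0 : (0 : ℝ) ≤ (Fintype.card K : ℝ)⁻¹ := by positivity
    have h1 : ∀ v : X × Y × Z, |P2 v - (Fintype.card K : ℝ)⁻¹ * ∑ k, ∑ m,
        (chanOut q V v.1 * T v.1 v.2.2) * (∑ l, e k v.1 (m, l)) *
          U v.2.2 (c (k, m, lh k v.2.2 m)) v.2.1|
        ≤ ∑ k, (Fintype.card K : ℝ)⁻¹ * ∑ i : M × L,
          |(Fintype.card (M × L) : ℝ)⁻¹ * ∑ i, V (c (k, i)) v.1 - chanOut q V v.1|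
            * e k v.1 i * T v.1 v.2.2 * U v.2.2 (c (k, i.1, lh k v.2.2 i.1)) v.2.1 := by
      intro v
      have hrew : P2 v - (Fintype.card K : ℝ)⁻¹ * ∑ k, ∑ m,
        (chanOut q V v.1 * T v.1 v.2.2) * (∑ l, e k v.1 (m, l)) *
          U v.2.2 (c (k, m, lh k v.2.2 m)) v.2.1
          = (Fintype.card K : ℝ)⁻¹ * ∑ k, ∑ i : M × L,
          ((Fintype.card (M × L) : ℝ)⁻¹ * (∑ i, V (c (k, i)) v.1) - chanOut q V v.1)
            * e k v.1 i * T v.1 v.2.2 * U v.2.2 (c (k, i.1, lh k v.2.2 i.1)) v.2.1 := by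
        rw [hP2, hNK]
        dsimp only
        rw [Fintype.sum_prod_type, mul_assoc, Finset.mul_sum (a := (Fintype.card (M × L) : ℝ)⁻¹),
          ← mul_sub, ← Finset.sum_sub_distrib]
        congr 1
        refine Finset.sum_congr rfl fun k _ => ?_
        have hr : ∑ m, chanOut q V v.1 * T v.1 v.2.2 * (∑ l, e k v.1 (m, l)) *
              U v.2.2 (c (k, m, lh k v.2.2 m)) v.2.1
            = ∑ i : M × L, chanOut q V v.1 * T v.1 v.2.2 * e k v.1 i *
              U v.2.2 (c (k, i.1, lh k v.2.2 i.1)) v.2.1 := by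
          rw [Fintype.sum_prod_type]
          refine Finset.sum_congr rfl fun m _ => ?_
          rw [Finset.mul_sum, Finset.sum_mul]
        rw [hr, Finset.mul_sum, ← Finset.sum_sub_distrib]
        refine Finset.sum_congr rfl fun i _ => ?_
        rw [← sum_mul_likelihoodEnc hV (fun i => c (k, i)) v.1 i]
        simp only [he]
        ring
      rw [hrew, abs_mul, abs_of_nonneg hK0, ← Finset.mul_sum]
      refine mul_le_mul_of_nonneg_left ?_ hK0
      refine (Finset.abs_sum_le_sum_abs _ _).trans (Finset.sum_le_sum fun k _ => ?_)
      refine (Finset.abs_sum_le_sum_abs _ _).trans (Finset.sum_le_sum fun i _ => ?_)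
      rw [abs_mul, abs_mul, abs_mul, abs_of_nonneg ((hepmf k _).1 _), abs_of_nonneg ((hT _).1 _),
        abs_of_nonneg ((hU _ _).1 _)]
    refine (Finset.sum_le_sum fun v _ => h1 v).trans (le_of_eq ?_)
    rw [Finset.sum_comm, Finset.mul_sum]
    refine Finset.sum_congr rfl fun k _ => ?_
    rw [← Finset.mul_sum]
    congr 1
    rw [Fintype.sum_prod_type]
    refine Finset.sum_congr rfl fun x _ => ?_
    rw [Finset.sum_comm]
    have h3 : ∀ i : M × L, ∑ yz : Y × Z,
        |(Fintype.card (M × L) : ℝ)⁻¹ * ∑ i, V (c (k, i)) x - chanOut q V x|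
            * e k x i * T x yz.2 * U yz.2 (c (k, i.1, lh k yz.2 i.1)) yz.1
        = |(Fintype.card (M × L) : ℝ)⁻¹ * ∑ i, V (c (k, i)) x - chanOut q V x| * e k x i := by
      intro i
      rw [Fintype.sum_prod_type, Finset.sum_comm]
      simp only [← Finset.mul_sum, (hU _ _).2, (hT _).2, mul_one]
    rw [Finset.sum_congr rfl fun i _ => h3 i, ← Finset.mul_sum, (hepmf k x).2, mul_one]
  refine le_trans ?_ (add_le_add (add_le_add le_rfl hdec) henc)
  rw [← Finset.sum_add_distrib, ← Finset.sum_add_distrib]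
  refine Finset.sum_le_sum fun v _ => ?_
  refine (abs_sub_le _ (P2 v) _).trans (add_le_add ?_ le_rfl)
  refine (abs_sub_le _ (N * ∑ j, jointChan V T U (c j) v) _).trans (add_le_add ?_ le_rfl)
  rw [abs_sub_comm]

/-- One-shot channel synthesis with side information at the decoder. -/
theorem exists_enc_dec_one_shot {q : W → ℝ} (hq : IsPMF q) {V : W → X → ℝ}
    (hV : ∀ w, IsPMF (V w)) {T : X → Z → ℝ} (hT : ∀ x, IsPMF (T x)) {U : Z → W → Y → ℝ}
    (hU : ∀ z w, IsPMF (U z w)) (K M L : Type*) [Fintype K] [Fintype M] [Fintype L]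
    [DecidableEq K] [DecidableEq M] [DecidableEq L] [Nonempty K] [Nonempty M] [Nonempty L]
    {G₁ G₂ G₃ : ℝ} (hG₁ : 0 < G₁) (hG₂ : 0 < G₂) (hG₃ : 0 < G₃) :
    ∃ enc : K → X → M → ℝ, ∃ dec : K → Z → M → Y → ℝ,
      (∀ k x, IsPMF (enc k x)) ∧ (∀ k z m, IsPMF (dec k z m)) ∧
      ∑ v : X × Y × Z, |chanOut q (jointChan V T U) v
          - (Fintype.card K : ℝ)⁻¹ * ∑ k, ∑ m,
            (chanOut q V v.1 * T v.1 v.2.2) * enc k v.1 m * dec k v.2.2 m v.2.1|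
        ≤ (√(G₁ / Fintype.card (K × M × L))
            + 2 * ∑ w, ∑ v, (if G₁ * chanOut q (jointChan V T U) v < jointChan V T U w v
              then q w * jointChan V T U w v else 0))
          + 2 * ((∑ w, ∑ z, if G₃ * chanOut q (fun w => chanOut (V w) T) z < chanOut (V w) T z
              then 0 else q w * chanOut (V w) T z) + ((Fintype.card L : ℝ) - 1) / G₃)
          + (√(G₂ / Fintype.card (M × L))
            + 2 * ∑ w, ∑ x, (if G₂ * chanOut q V x < V w x then q w * V w x else 0)) := by
  set VZ : W → Z → ℝ := fun w => chanOut (V w) T with hVZ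
  have hVZpmf : ∀ w, IsPMF (VZ w) := fun w => chanOut_isPMF (hV w) hT
  suffices h : ∃ c : K × M × L → W,
      (∑ v, |(Fintype.card (K × M × L) : ℝ)⁻¹ * ∑ j, jointChan V T U (c j) v
              - chanOut q (jointChan V T U) v|)
          + 2 * ((Fintype.card (K × M × L) : ℝ)⁻¹ * ∑ j : K × M × L, ∑ z, chanOut (V (c j)) T z *
              (if thresholdDecode VZ (fun z => G₃ * chanOut q VZ z) (fun l => c (j.1, j.2.1, l)) z
                = j.2.2 then 0 else 1))
          + (Fintype.card K : ℝ)⁻¹ * ∑ k, ∑ x, |(Fintype.card (M × L) : ℝ)⁻¹ *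
              ∑ i, V (c (k, i)) x - chanOut q V x| ≤ _ by
    obtain ⟨c, hc⟩ := h
    obtain ⟨enc, dec, h1, h2, h3⟩ := exists_enc_dec_of_codebook (q := q) hV hT hU
      (fun z => G₃ * chanOut q VZ z) c
    exact ⟨enc, dec, h1, h2, h3.trans hc⟩
  refine exists_le_of_iidExp_le hq ?_
  rw [iidExp_add, iidExp_add, iidExp_const_mul, iidExp_const_mul, iidExp_const_mul]
  have hJ : (0 : ℝ) < Fintype.card (K × M × L) := by exact_mod_cast Fintype.card_pos
  have hK : (0 : ℝ) < Fintype.card K := by exact_mod_cast Fintype.card_pos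
  refine add_le_add (add_le_add ?_ ?_) ?_
  · have := iidExp_soft_covering_le (J := K × M × L) hq (jointChan_isPMF hV hT hU) Finset.univ
      Finset.univ_nonempty hG₁
    simpa only [Finset.card_univ] using this
  · refine mul_le_mul_of_nonneg_left ?_ (by norm_num)
    rw [iidExp_sum, inv_mul_le_iff₀ hJ]
    refine (Finset.sum_le_sum fun j _ => iidExp_thresholdDecode_error_le (J := K × M × L)
      (e := fun l => (j.1, j.2.1, l)) hq hVZpmf hG₃ ?_ j.2.2).trans ?_
    · intro l l' h
      simpa using h
    · rw [Finset.sum_const, Finset.card_univ, nsmul_eq_mul]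
  · rw [iidExp_sum, inv_mul_le_iff₀ hK]
    refine (Finset.sum_le_sum (g := fun _ => (√(G₂ / Fintype.card (M × L))
            + 2 * ∑ w, ∑ x, (if G₂ * chanOut q V x < V w x then q w * V w x else 0)))
      fun k _ => ?_).trans ?_
    · have := iidExp_soft_covering_le (J := K × M × L) hq hV
        (Finset.univ.map ⟨fun i : M × L => (k, i), fun i i' h => by simpa using h⟩)
        (by simp) hG₂
      simp only [Finset.card_map, Finset.sum_map, Finset.card_univ] at this
      exact this
    · rw [Finset.sum_const, Finset.card_univ, nsmul_eq_mul]

end OneShotSynthesis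

section ProductChannels

set_option linter.unusedSectionVars false

variable {W A : Type*} [Fintype W] [Fintype A]

/-- The `n`-fold product of a channel. -/
def nfold {n : ℕ} (V : W → A → ℝ) (w : Fin n → W) (a : Fin n → A) : ℝ :=
  ∏ i, V (w i) (a i)

lemma nfold_isPMF {n : ℕ} {V : W → A → ℝ} (hV : ∀ w, IsPMF (V w)) (w : Fin n → W) :
    IsPMF (nfold V w) :=
  ⟨fun _ => Finset.prod_nonneg fun _ _ => (hV _).1 _, by
    simp only [nfold]
    rw [sum_prod_eq_prod_sum (fun i => V (w i))]
    simp [(hV _).2]⟩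

lemma chanOut_nfold {n : ℕ} (q : W → ℝ) (V : W → A → ℝ) (a : Fin n → A) :
    chanOut (fun w : Fin n → W => ∏ i, q (w i)) (nfold V) a = ∏ i, chanOut q V (a i) := by
  simp only [chanOut, nfold, ← Finset.prod_mul_distrib]
  exact sum_prod_eq_prod_sum (fun i w => q w * V w (a i))

/-- Information density of the channel `V` under the input distribution `q`. -/
def infoDensity (q : W → ℝ) (V : W → A → ℝ) (b : W × A) : ℝ :=
  Real.logb 2 (V b.1 b.2 / chanOut q V b.2)

/-- Mutual information between the input and the output of the channel `V`. -/
def chanInfo (q : W → ℝ) (V : W → A → ℝ) : ℝ :=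
  ∑ b : W × A, q b.1 * V b.1 b.2 * infoDensity q V b

/-- Variance of the information density. -/
def chanVar (q : W → ℝ) (V : W → A → ℝ) : ℝ :=
  ∑ b : W × A, q b.1 * V b.1 b.2 * (infoDensity q V b - chanInfo q V) ^ 2

lemma inputOutput_isPMF {q : W → ℝ} (hq : IsPMF q) {V : W → A → ℝ} (hV : ∀ w, IsPMF (V w)) :
    IsPMF (fun b : W × A => q b.1 * V b.1 b.2) :=
  ⟨fun b => mul_nonneg (hq.1 _) ((hV _).1 _), by
    simp [Fintype.sum_prod_type, ← Finset.mul_sum, (hV _).2, hq.2]⟩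

lemma logb_nfold_div {q : W → ℝ} (hq : IsPMF q) {V : W → A → ℝ} (hV : ∀ w, IsPMF (V w)) {n : ℕ}
    {w : Fin n → W} {a : Fin n → A} (h : (∏ i, q (w i)) * nfold V w a ≠ 0) :
    0 < nfold V w a ∧ 0 < ∏ i, chanOut q V (a i) ∧
      Real.logb 2 (nfold V w a / ∏ i, chanOut q V (a i))
        = ∑ i, infoDensity q V (w i, a i) := by
  have hVp : ∀ i, 0 < V (w i) (a i) := fun i =>
    lt_of_le_of_ne ((hV _).1 _) (Ne.symm
      (Finset.prod_ne_zero_iff.mp (right_ne_zero_of_mul h) i (Finset.mem_univ i)))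
  have hqp : ∀ i, 0 < q (w i) := fun i =>
    lt_of_le_of_ne (hq.1 _) (Ne.symm
      (Finset.prod_ne_zero_iff.mp (left_ne_zero_of_mul h) i (Finset.mem_univ i)))
  have hop : ∀ i, 0 < chanOut q V (a i) := fun i =>
    lt_of_lt_of_le (mul_pos (hqp i) (hVp i))
      (Finset.single_le_sum (f := fun w => q w * V w (a i))
        (fun w _ => mul_nonneg (hq.1 w) ((hV w).1 _)) (Finset.mem_univ (w i)))
  refine ⟨Finset.prod_pos fun i _ => hVp i, Finset.prod_pos fun i _ => hop i, ?_⟩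
  rw [nfold, ← Finset.prod_div_distrib, Real.logb_prod]
  · rfl
  · exact fun i _ => (div_pos (hVp i) (hop i)).ne'

lemma sum_input_output_le {q : W → ℝ} (hq : IsPMF q) {V : W → A → ℝ} (hV : ∀ w, IsPMF (V w))
    {n : ℕ} (hn : 0 < n) {δ : ℝ} (hδ : 0 < δ) (P : (Fin n → W) → (Fin n → A) → Prop)
    (hP : ∀ w a, (∏ i, q (w i)) * nfold V w a ≠ 0 → P w a →
      n * δ ≤ |∑ i, infoDensity q V (w i, a i) - n * chanInfo q V|) :
    ∑ w, ∑ a, (if P w a then (∏ i, q (w i)) * nfold V w a else 0)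
      ≤ chanVar q V / (n * δ ^ 2) := by
  have h := sum_prod_large_deviation_le (inputOutput_isPMF hq hV) (infoDensity q V) hn hδ
  refine le_trans ?_ h
  rw [← Fintype.sum_prod_type', ← Equiv.sum_comp (Equiv.arrowProdEquivProdArrow (Fin n)
    (fun _ => W) (fun _ => A))]
  refine Finset.sum_le_sum fun c _ => ?_
  change (if P (fun i => (c i).1) (fun i => (c i).2) then
    (∏ i, q (c i).1) * nfold V (fun i => (c i).1) (fun i => (c i).2) else 0) ≤ _
  have hnn : 0 ≤ ∏ i, q (c i).1 * V (c i).1 (c i).2 :=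
    (prod_isPMF (inputOutput_isPMF hq hV)).1 c
  have heq : (∏ i, q (c i).1) * nfold V (fun i => (c i).1) (fun i => (c i).2)
      = ∏ i, q (c i).1 * V (c i).1 (c i).2 := by
    rw [nfold, ← Finset.prod_mul_distrib]
  by_cases h1 : P (fun i => (c i).1) (fun i => (c i).2)
  · rw [if_pos h1]
    by_cases h0 : (∏ i, q (c i).1) * nfold V (fun i => (c i).1) (fun i => (c i).2) = 0
    · rw [h0]
      split_ifs
      · exact hnn
      · exact le_rfl
    · have := hP _ _ h0 h1
      rw [heq, if_pos]
      exact this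
  · rw [if_neg h1]
    split_ifs
    · exact hnn
    · exact le_rfl

lemma sum_density_gt_le {q : W → ℝ} (hq : IsPMF q) {V : W → A → ℝ} (hV : ∀ w, IsPMF (V w))
    {n : ℕ} (hn : 0 < n) {δ : ℝ} (hδ : 0 < δ) :
    ∑ w : Fin n → W, ∑ a, (if (2 : ℝ) ^ (n * (chanInfo q V + δ)) *
        chanOut (fun w : Fin n → W => ∏ i, q (w i)) (nfold V) a < nfold V w a
      then (∏ i, q (w i)) * nfold V w a else 0) ≤ chanVar q V / (n * δ ^ 2) := by
  refine sum_input_output_le hq hV hn hδ _ fun w a h0 h => ?_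
  obtain ⟨h1, h2, h3⟩ := logb_nfold_div hq hV h0
  rw [chanOut_nfold, ← lt_div_iff₀ h2] at h
  have := Real.logb_lt_logb (b := 2) (by norm_num) (by positivity) h
  rw [h3, Real.logb_rpow (by norm_num) (by norm_num)] at this
  refine le_trans ?_ (le_abs_self _)
  linarith

lemma sum_density_le_le {q : W → ℝ} (hq : IsPMF q) {V : W → A → ℝ} (hV : ∀ w, IsPMF (V w))
    {n : ℕ} (hn : 0 < n) {δ : ℝ} (hδ : 0 < δ) :
    ∑ w : Fin n → W, ∑ a, (if (2 : ℝ) ^ (n * (chanInfo q V - δ)) *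
        chanOut (fun w : Fin n → W => ∏ i, q (w i)) (nfold V) a < nfold V w a
      then 0 else (∏ i, q (w i)) * nfold V w a) ≤ chanVar q V / (n * δ ^ 2) := by
  have := sum_input_output_le hq hV hn hδ (fun w a => ¬ ((2 : ℝ) ^ (n * (chanInfo q V - δ)) *
        chanOut (fun w : Fin n → W => ∏ i, q (w i)) (nfold V) a < nfold V w a))
    fun w a h0 h => ?_
  · refine le_trans (le_of_eq ?_) this
    refine Finset.sum_congr rfl fun w _ => Finset.sum_congr rfl fun a _ => ?_
    by_cases h : (2 : ℝ) ^ (n * (chanInfo q V - δ)) *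
        chanOut (fun w : Fin n → W => ∏ i, q (w i)) (nfold V) a < nfold V w a <;> simp [h]
  obtain ⟨h1, h2, h3⟩ := logb_nfold_div hq hV h0
  rw [chanOut_nfold, ← lt_div_iff₀ h2, not_lt] at h
  have := Real.logb_le_logb_of_le (b := 2) (by norm_num) (by positivity) h
  rw [h3, Real.logb_rpow (by norm_num) (by norm_num)] at this
  refine le_trans ?_ (neg_le_abs _)
  linarith

end ProductChannels

section MutualInformation

variable {α β : Type*} [Fintype α] [Fintype β]

lemma Hent_push {p : α → ℝ} (f : α → β) :
    Hent (push p f) = ∑ a, p a * -Real.logb 2 (push p f (f a)) := by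
  rw [← sum_push_mul p f (fun b => -Real.logb 2 (push p f b))]
  simp [Hent]

lemma I2_eq_sum {r : α × β → ℝ} (hr : ∀ x, 0 ≤ r x) :
    I2 r = ∑ x, r x * Real.logb 2 (r x / (push r Prod.fst x.1 * push r Prod.snd x.2)) := by
  rw [I2, Hent_push, Hent_push, Hent, ← Finset.sum_add_distrib, ← Finset.sum_sub_distrib]
  refine Finset.sum_congr rfl fun x _ => ?_
  rcases (hr x).eq_or_lt with h | h
  · simp [← h]
  · have h1 := h.trans_le (le_push hr Prod.fst x)
    have h2 := h.trans_le (le_push hr Prod.snd x)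
    rw [Real.logb_div h.ne' (by positivity), Real.logb_mul h1.ne' h2.ne']
    ring

lemma I2_swap_eq_chanInfo {q : β → ℝ} (hq : IsPMF q) {V : β → α → ℝ} (hV : ∀ w, IsPMF (V w))
    {r : α × β → ℝ} (hr : ∀ a b, r (a, b) = q b * V b a) : I2 r = chanInfo q V := by
  have h1 : ∀ a, push r Prod.fst a = chanOut q V a := fun a => by
    rw [push_fst]
    exact Finset.sum_congr rfl fun b _ => hr a b
  have h2 : ∀ b, push r Prod.snd b = q b := fun b => by
    rw [push_snd]
    simp [hr, ← Finset.mul_sum, (hV b).2]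
  rw [I2_eq_sum (fun x => by rw [← Prod.mk.eta (p := x), hr]
                             exact mul_nonneg (hq.1 _) ((hV _).1 _)), chanInfo,
    ← Equiv.sum_comp (Equiv.prodComm α β)]
  refine Finset.sum_congr rfl fun x _ => ?_
  obtain ⟨a, b⟩ := x
  simp only [hr, h1, h2, infoDensity, Equiv.prodComm_apply, Prod.swap_prod_mk]
  by_cases hb : q b = 0
  · simp [hb]
  · rw [mul_comm (chanOut q V a) (q b), mul_div_mul_left _ _ hb]

lemma I2_eq_chanInfo {q : β → ℝ} (hq : IsPMF q) {V : β → α → ℝ} (hV : ∀ w, IsPMF (V w))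
    {r : β × α → ℝ} (hr : ∀ b a, r (b, a) = q b * V b a) : I2 r = chanInfo q V := by
  have h1 : ∀ a, push r Prod.snd a = chanOut q V a := fun a => by
    rw [push_snd]
    exact Finset.sum_congr rfl fun b _ => hr b a
  have h2 : ∀ b, push r Prod.fst b = q b := fun b => by
    rw [push_fst]
    simp [hr, ← Finset.mul_sum, (hV b).2]
  rw [I2_eq_sum (fun x => by rw [← Prod.mk.eta (p := x), hr]
                             exact mul_nonneg (hq.1 _) ((hV _).1 _)), chanInfo]
  refine Finset.sum_congr rfl fun x _ => ?_
  obtain ⟨b, a⟩ := x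
  simp only [hr, h1, h2, infoDensity]
  by_cases hb : q b = 0
  · simp [hb]
  · rw [mul_div_mul_left _ _ hb]

/-- Conditional distribution of the second component given the first, set to the second marginal
where the conditioning event has probability zero. -/
def condKernel (r : α × β → ℝ) (a : α) (b : β) : ℝ :=
  if push r Prod.fst a = 0 then push r Prod.snd b else r (a, b) / push r Prod.fst a

lemma condKernel_isPMF {r : α × β → ℝ} (hr : IsPMF r) (a : α) : IsPMF (condKernel r a) := by
  by_cases h : push r Prod.fst a = 0
  · have : condKernel r a = push r Prod.snd := by
      funext b
      rw [condKernel, if_pos h]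
    rw [this]
    exact hr.push _
  · refine ⟨fun b => ?_, ?_⟩
    · rw [condKernel, if_neg h]
      exact div_nonneg (hr.1 _) (push_nonneg hr.1 _ _)
    · simp only [condKernel, if_neg h]
      rw [← Finset.sum_div, ← push_fst, div_self h]

lemma push_fst_mul_condKernel {r : α × β → ℝ} (hr : ∀ x, 0 ≤ r x) (a : α) (b : β) :
    push r Prod.fst a * condKernel r a b = r (a, b) := by
  rw [condKernel]
  split_ifs with h
  · have := le_push hr Prod.fst (a, b)
    rw [h, zero_mul]
    rw [h] at this
    exact le_antisymm (hr _) this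
  · field_simp

end MutualInformation

section Achievability

set_option linter.unusedSectionVars false

variable {W X Y Z : Type*} [Fintype W] [Fintype X] [Fintype Y] [Fintype Z]

/-- Triples of sequences correspond to sequences of triples. -/
def zipEquiv (n : ℕ) (X Y Z : Type*) :
    (Fin n → X × Y × Z) ≃ (Fin n → X) × (Fin n → Y) × (Fin n → Z) where
  toFun c := (fun i => (c i).1, fun i => (c i).2.1, fun i => (c i).2.2)
  invFun v i := (v.1 i, v.2.1 i, v.2.2 i)
  left_inv _ := rfl
  right_inv _ := rfl

lemma jointChan_nfold {n : ℕ} (V : W → X → ℝ) (T : X → Z → ℝ) (U : Z → W → Y → ℝ)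
    (w : Fin n → W) (c : Fin n → X × Y × Z) :
    jointChan (nfold V) (nfold T) (fun z w y => ∏ i, U (z i) (w i) (y i)) w (zipEquiv n X Y Z c)
      = nfold (jointChan V T U) w c := by
  simp [jointChan, nfold, zipEquiv, Finset.prod_mul_distrib]

lemma chanOut_nfold_nfold {n : ℕ} (V : W → X → ℝ) (T : X → Z → ℝ) :
    (fun w : Fin n → W => chanOut (nfold V w) (nfold T)) = nfold fun w => chanOut (V w) T := by
  funext w z
  simp only [chanOut, nfold, ← Finset.prod_mul_distrib]
  exact sum_prod_eq_prod_sum (fun i x => V (w i) x * T x (z i))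

lemma sqrt_two_rpow_div_le {n : ℕ} {a b δ : ℝ} {N : ℝ} (hN : (2 : ℝ) ^ (n * b) ≤ N)
    (h : a + 2 * δ ≤ b) : √((2 : ℝ) ^ (n * a) / N) ≤ (2 : ℝ) ^ (-(n * δ)) := by
  rw [Real.sqrt_le_iff]
  have hb : (0 : ℝ) < 2 ^ (n * b) := by positivity
  refine ⟨by positivity, ?_⟩
  rw [div_le_iff₀ (hb.trans_le hN)]
  refine le_trans ?_ (mul_le_mul_of_nonneg_left hN (by positivity))
  rw [← Real.rpow_natCast, ← Real.rpow_mul (by norm_num), ← Real.rpow_add (by norm_num)]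
  refine Real.rpow_le_rpow_of_exponent_le (by norm_num) ?_
  have := mul_le_mul_of_nonneg_left h (Nat.cast_nonneg (α := ℝ) n)
  push_cast
  linarith

lemma two_rpow_le_NC (n : ℕ) (C : ℝ) : (2 : ℝ) ^ (n * C) ≤ NC n C := Nat.le_ceil _

lemma NC_pos (n : ℕ) (C : ℝ) : 0 < NC n C := Nat.ceil_pos.mpr (by positivity)

lemma logb_NC_le {n : ℕ} {C : ℝ} (hC : 0 ≤ C) : Real.logb 2 (NC n C) ≤ n * C + 1 := by
  have h1 : (1 : ℝ) ≤ 2 ^ (n * C) := Real.one_le_rpow (by norm_num) (by positivity)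
  have h2 : (NC n C : ℝ) ≤ 2 ^ (n * C + 1) := by
    rw [Real.rpow_add (by norm_num), Real.rpow_one]
    have := Nat.ceil_lt_add_one (a := (2 : ℝ) ^ (n * C)) (by positivity)
    rw [NC]
    linarith
  have h3 : (0 : ℝ) < NC n C := by exact_mod_cast NC_pos n C
  calc _ ≤ Real.logb 2 (2 ^ (n * C + 1)) := Real.logb_le_logb_of_le (by norm_num) h3 h2
    _ = _ := Real.logb_rpow (by norm_num) (by norm_num)

lemma exists_enc_dec_nfold {q : W → ℝ} (hq : IsPMF q) {V : W → X → ℝ}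
    (hV : ∀ w, IsPMF (V w)) {T : X → Z → ℝ} (hT : ∀ x, IsPMF (T x)) {U : Z → W → Y → ℝ}
    (hU : ∀ z w, IsPMF (U z w)) {R C : ℝ}
    (h₁ : chanInfo q V - chanInfo q (fun w => chanOut (V w) T) ≤ R)
    (h₂ : chanInfo q (jointChan V T U) - chanInfo q (fun w => chanOut (V w) T) ≤ R + C)
    {δ : ℝ} (hδ : 0 < δ) {n : ℕ} (hn : 0 < n) :
    ∃ enc : Fin (NC n C) → (Fin n → X) → Fin (NC n (R + 5 * δ)) → ℝ,
    ∃ dec : Fin (NC n C) → (Fin n → Z) → Fin (NC n (R + 5 * δ)) → (Fin n → Y) → ℝ,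
      (∀ k x, IsPMF (enc k x)) ∧ (∀ k z m, IsPMF (dec k z m)) ∧
      ∑ v : (Fin n → X) × (Fin n → Y) × (Fin n → Z),
        |∏ i, chanOut q (jointChan V T U) (v.1 i, v.2.1 i, v.2.2 i)
          - (NC n C : ℝ)⁻¹ * ∑ k, ∑ m,
            (∏ i, chanOut q V (v.1 i) * T (v.1 i) (v.2.2 i)) * enc k v.1 m * dec k v.2.2 m v.2.1|
        ≤ 4 * 2 ^ (-(n * δ)) + 2 * (chanVar q (jointChan V T U)
          + chanVar q (fun w => chanOut (V w) T) + chanVar q V) / (n * δ ^ 2) := by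
  set J := jointChan V T U with hJ
  set VZ : W → Z → ℝ := fun w => chanOut (V w) T with hVZ
  have hJp : ∀ w, IsPMF (J w) := jointChan_isPMF hV hT hU
  have hVZp : ∀ w, IsPMF (VZ w) := fun w => chanOut_isPMF (hV w) hT
  have : Nonempty (Fin (NC n C)) := ⟨⟨0, NC_pos _ _⟩⟩
  have : Nonempty (Fin (NC n (R + 5 * δ))) := ⟨⟨0, NC_pos _ _⟩⟩
  set l := ⌊(2 : ℝ) ^ (n * (chanInfo q VZ - 2 * δ))⌋₊ with hl
  have hUn : ∀ (z : Fin n → Z) (w : Fin n → W),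
      IsPMF (fun y : Fin n → Y => ∏ i, U (z i) (w i) (y i)) := fun z w =>
    nfold_isPMF (V := fun b : Z × W => U b.1 b.2) (fun b => hU b.1 b.2) (fun i => (z i, w i))
  obtain ⟨enc, dec, he, hd, h⟩ := exists_enc_dec_one_shot (prod_isPMF (J := Fin n) hq)
    (nfold_isPMF hV) (nfold_isPMF hT) hUn (Fin (NC n C)) (Fin (NC n (R + 5 * δ))) (Fin (l + 1))
    (G₁ := 2 ^ (n * (chanInfo q J + δ))) (G₂ := 2 ^ (n * (chanInfo q V + δ)))
    (G₃ := 2 ^ (n * (chanInfo q VZ - δ))) (by positivity) (by positivity) (by positivity)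
  have hch : ∀ c : Fin n → X × Y × Z, chanOut (fun w : Fin n → W => ∏ i, q (w i))
      (jointChan (nfold V) (nfold T) (fun z w y => ∏ i, U (z i) (w i) (y i)))
      (zipEquiv n X Y Z c) = chanOut (fun w : Fin n → W => ∏ i, q (w i)) (nfold J) c := by
    intro c
    simp only [chanOut, jointChan_nfold, ← hJ]
  refine ⟨enc, dec, he, hd, ?_⟩
  calc _ = _ := ?_
    _ ≤ _ := h
    _ ≤ ((2 : ℝ) ^ (-(n * δ)) + 2 * (chanVar q J / (n * δ ^ 2)))
        + 2 * (chanVar q VZ / (n * δ ^ 2) + 2 ^ (-(n * δ)))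
        + ((2 : ℝ) ^ (-(n * δ)) + 2 * (chanVar q V / (n * δ ^ 2))) := ?_
    _ = _ := by ring
  · refine Finset.sum_congr rfl fun v _ => ?_
    obtain ⟨c, rfl⟩ := (zipEquiv n X Y Z).surjective v
    rw [hch, chanOut_nfold, Fintype.card_fin]
    simp only [chanOut_nfold, Finset.prod_mul_distrib]
    rfl
  · have hlL : (2 : ℝ) ^ (n * (chanInfo q VZ - 2 * δ)) ≤ ((l + 1 : ℕ) : ℝ) := by
      push_cast
      exact (Nat.lt_floor_add_one _).le
    have hML : (2 : ℝ) ^ (n * (R + chanInfo q VZ + 3 * δ))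
        ≤ Fintype.card (Fin (NC n (R + 5 * δ)) × Fin (l + 1)) := by
      rw [Fintype.card_prod, Fintype.card_fin, Fintype.card_fin, Nat.cast_mul]
      refine le_trans (le_of_eq ?_) (mul_le_mul (two_rpow_le_NC _ _) hlL (by positivity)
        (by positivity))
      rw [← Real.rpow_add (by norm_num)]
      ring_nf
    have hKML : (2 : ℝ) ^ (n * (R + C + chanInfo q VZ + 3 * δ))
        ≤ Fintype.card (Fin (NC n C) × Fin (NC n (R + 5 * δ)) × Fin (l + 1)) := by
      rw [Fintype.card_prod, Nat.cast_mul]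
      refine le_trans (le_of_eq ?_) (mul_le_mul ((two_rpow_le_NC n C).trans_eq (by simp)) hML
        (by positivity) (by positivity))
      rw [← Real.rpow_add (by norm_num)]
      ring_nf
    refine add_le_add (add_le_add (add_le_add ?_ ?_) ?_) (add_le_add ?_ ?_)
    · exact sqrt_two_rpow_div_le hKML (by linarith)
    · refine mul_le_mul_of_nonneg_left ?_ (by norm_num)
      refine le_trans (le_of_eq ?_) (sum_density_gt_le hq hJp hn hδ)
      refine Finset.sum_congr rfl fun w _ => ?_
      rw [← Equiv.sum_comp (zipEquiv n X Y Z)]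
      refine Finset.sum_congr rfl fun c _ => ?_
      rw [hch, jointChan_nfold]
    · refine mul_le_mul_of_nonneg_left (add_le_add ?_ ?_) (by norm_num)
      · have := sum_density_le_le hq hVZp hn hδ
        simp only [← chanOut_nfold_nfold, hVZ] at this ⊢
        exact this
      · rw [Fintype.card_fin, div_le_iff₀ (by positivity), ← Real.rpow_add (by norm_num)]
        push_cast
        rw [add_sub_cancel_right]
        refine (Nat.floor_le (by positivity)).trans (le_of_eq ?_)
        ring_nf
    · exact sqrt_two_rpow_div_le hML (by linarith)
    · exact mul_le_mul_of_nonneg_left (sum_density_gt_le hq hV hn hδ) (by norm_num)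

end Achievability

section Factorization

variable {α : Type*} [Fintype α]

lemma push_congr {δ ε : Type*} {p : α → ℝ} {f : α → δ} {g : α → ε} {b : δ} {c : ε}
    (h : ∀ a, f a = b ↔ g a = c) : push p f b = push p g c :=
  Finset.sum_congr rfl fun a _ => by simp only [h]

lemma push_eq_sum_push {δ ε : Type*} [Fintype δ] [Fintype ε] (p : α → ℝ) (f : α → δ) (g : α → ε)
    (b : δ) : push p f b = ∑ c, push p (fun a => (g a, f a)) (c, b) := by
  rw [← push_snd, push_push]

variable {W X Y Z : Type*} [Fintype W] [Fintype X] [Fintype Y] [Fintype Z]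

lemma push_triple_eq_of_markov {q : W × X × Y × Z → ℝ} (hq : IsPMF q)
    (hm : Markov (push q (fun u => (u.2.2.2, u.2.1, u.1)))) (w : W) (x : X) (z : Z) :
    push q (fun u => (u.1, u.2.1, u.2.2.2)) (w, x, z)
      = push q (fun u => (u.1, u.2.1)) (w, x)
        * condKernel (push q (fun u => (u.2.1, u.2.2.2))) x z := by
  have h := hm z x w
  simp only [push_push] at h
  have h1 := push_fst_mul_condKernel (r := push q (fun u => (u.2.1, u.2.2.2)))
    (push_nonneg hq.1 _) x z
  simp only [push_push] at h1
  rw [push_congr (g := fun u : W × X × Y × Z => (u.1, u.2.1, u.2.2.2)) (c := (w, x, z))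
      (fun u => by simp; tauto),
    push_congr (f := fun u : W × X × Y × Z => (u.2.2.2, u.2.1)) (b := (z, x))
      (g := fun u => (u.2.1, u.2.2.2)) (c := (x, z))
      (fun u => by simp; tauto),
    push_congr (f := fun u : W × X × Y × Z => (u.2.1, u.1)) (b := (x, w))
      (g := fun u => (u.1, u.2.1)) (c := (w, x))
      (fun u => by simp; tauto), ← h1] at h
  by_cases h0 : push q (fun u => u.2.1) x = 0
  · have h2 := push_le_push_comp hq.1 (fun u => (u.1, u.2.1, u.2.2.2)) (fun c => c.2.1) (w, x, z)
    have h3 := push_le_push_comp hq.1 (fun u => (u.1, u.2.1)) Prod.snd (w, x)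
    have h4 := push_nonneg hq.1 (fun u => (u.1, u.2.1, u.2.2.2)) (w, x, z)
    have h5 := push_nonneg hq.1 (fun u => (u.1, u.2.1)) (w, x)
    simp only [h0] at h2 h3
    rw [le_antisymm h2 h4, le_antisymm h3 h5, zero_mul]
  · apply mul_right_cancel₀ h0
    linear_combination h

lemma eq_push_triple_mul_of_markov {q : W × X × Y × Z → ℝ} (hq : IsPMF q)
    (hm : Markov (push q (fun u => (u.2.1, (u.2.2.2, u.1), u.2.2.1))))
    (w : W) (x : X) (y : Y) (z : Z) :
    q (w, x, y, z) = push q (fun u => (u.1, u.2.1, u.2.2.2)) (w, x, z)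
        * condKernel (push q (fun u => ((u.2.2.2, u.1), u.2.2.1))) (z, w) y := by
  have h := hm x (z, w) y
  simp only [push_push] at h
  have h1 := push_fst_mul_condKernel (r := push q (fun u => ((u.2.2.2, u.1), u.2.2.1)))
    (push_nonneg hq.1 _) (z, w) y
  simp only [push_push] at h1
  rw [push_congr (g := id) (c := (w, x, y, z)) (fun u => by simp [Prod.ext_iff]; tauto),
    push_congr (f := fun u : W × X × Y × Z => (u.2.1, (u.2.2.2, u.1)))
      (b := (x, (z, w))) (g := fun u => (u.1, u.2.1, u.2.2.2))
      (c := (w, x, z)) (fun u => by simp; tauto), ← h1] at h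
  have hid : push q id (w, x, y, z) = q (w, x, y, z) :=
    push_injective q Function.injective_id _
  rw [hid] at h
  by_cases h0 : push q (fun u => (u.2.2.2, u.1)) (z, w) = 0
  · have h2 := push_le_push_comp hq.1 (fun u => (u.1, u.2.1, u.2.2.2)) (fun c => (c.2.2, c.1))
      (w, x, z)
    have h3 := le_push hq.1 (fun u => (u.2.2.2, u.1)) (w, x, y, z)
    have h4 := push_nonneg hq.1 (fun u => (u.1, u.2.1, u.2.2.2)) (w, x, z)
    simp only [h0] at h2 h3
    rw [le_antisymm h2 h4, le_antisymm h3 (hq.1 _), zero_mul]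
  · apply mul_right_cancel₀ h0
    linear_combination h

end Factorization

section Direct

variable {X Y Z : Type} [Fintype X] [Fintype Y] [Fintype Z]

theorem rsAchievable_of_auxiliary {W : Type*} [Fintype W] {p : X × Y × Z → ℝ} {R C : ℝ}
    (hR : 0 ≤ R) {q : W × X × Y × Z → ℝ} (hq : IsPMF q)
    (hqp : ∀ v, push q Prod.snd v = p v)
    (hm₁ : Markov (push q (fun u => (u.2.2.2, u.2.1, u.1))))
    (hm₂ : Markov (push q (fun u => (u.2.1, (u.2.2.2, u.1), u.2.2.1))))
    (h₁ : I2 (push q (fun u => (u.2.1, u.1))) - I2 (push q (fun u => (u.1, u.2.2.2))) ≤ R)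
    (h₂ : I2 (push q (fun u => (u.2, u.1))) - I2 (push q (fun u => (u.1, u.2.2.2))) ≤ R + C) :
    RsAchievable p R C := by
  set qW := push q Prod.fst with hqW
  set V : W → X → ℝ := condKernel (push q (fun u => (u.1, u.2.1))) with hV
  set T : X → Z → ℝ := condKernel (push q (fun u => (u.2.1, u.2.2.2))) with hT
  set U : Z → W → Y → ℝ := fun z w =>
    condKernel (push q (fun u => ((u.2.2.2, u.1), u.2.2.1))) (z, w) with hU
  have hqWp : IsPMF qW := hq.push _
  have hVp : ∀ w, IsPMF (V w) := condKernel_isPMF (hq.push _)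
  have hTp : ∀ x, IsPMF (T x) := condKernel_isPMF (hq.push _)
  have hUp : ∀ z w, IsPMF (U z w) := fun z w => condKernel_isPMF (hq.push _) _
  have hqV : ∀ w x, qW w * V w x = push q (fun u => (u.1, u.2.1)) (w, x) := fun w x => by
    have := push_fst_mul_condKernel (r := push q (fun u => (u.1, u.2.1)))
      (push_nonneg hq.1 _) w x
    rwa [push_push] at this
  have hqVT : ∀ w x z, qW w * V w x * T x z
      = push q (fun u => (u.1, u.2.1, u.2.2.2)) (w, x, z) := fun w x z => by
    rw [hqV, push_triple_eq_of_markov hq hm₁]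
  have hqJ : ∀ w v, q (w, v) = qW w * jointChan V T U w v := by
    rintro w ⟨x, y, z⟩
    rw [eq_push_triple_mul_of_markov hq hm₂, ← hqVT, jointChan]
    ring
  have hout : ∀ v, chanOut qW (jointChan V T U) v = p v := fun v => by
    rw [← hqp, push_snd, chanOut]
    exact Finset.sum_congr rfl fun w _ => (hqJ w v).symm
  have hXZ : ∀ x z, chanOut qW V x * T x z = push p (fun v => (v.1, v.2.2)) (x, z) := by
    intro x z
    have hp : p = push q Prod.snd := funext fun v => (hqp v).symm
    have h := push_fst_mul_condKernel (r := push q (fun u => (u.2.1, u.2.2.2)))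
      (push_nonneg hq.1 _) x z
    rw [push_push] at h
    rw [hp, push_push, ← h]
    congr 1
    rw [push_eq_sum_push q _ (fun u => u.1), chanOut]
    exact Finset.sum_congr rfl fun w _ => hqV w x
  rw [I2_swap_eq_chanInfo hqWp hVp (fun x w => by
      rw [hqV]
      exact push_congr fun u => by simp; tauto),
    I2_eq_chanInfo hqWp (V := fun w => chanOut (V w) T) (fun w => chanOut_isPMF (hVp w) hTp)
      (fun w z => by
        rw [push_eq_sum_push q _ (fun u => u.2.1), chanOut, Finset.mul_sum]
        refine Finset.sum_congr rfl fun x _ => ?_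
        rw [← mul_assoc, hqVT]
        exact push_congr fun u => by simp; tauto)] at h₁
  rw [I2_swap_eq_chanInfo hqWp (jointChan_isPMF hVp hTp hUp) (fun v w => by
      rw [← hqJ]
      exact push_injective q (f := fun u : W × X × Y × Z => (u.2, u.1))
        (fun u u' h => by simpa [Prod.ext_iff, and_comm, and_assoc] using h) (w, v)),
    I2_eq_chanInfo hqWp (V := fun w => chanOut (V w) T) (fun w => chanOut_isPMF (hVp w) hTp)
      (fun w z => by
        rw [push_eq_sum_push q _ (fun u => u.2.1), chanOut, Finset.mul_sum]
        refine Finset.sum_congr rfl fun x _ => ?_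
        rw [← mul_assoc, hqVT]
        exact push_congr fun u => by simp; tauto)] at h₂
  intro ε hε
  set δ := ε / 6 with hδ
  have hδ0 : 0 < δ := by positivity
  set s := chanVar qW (jointChan V T U) + chanVar qW (fun w => chanOut (V w) T) + chanVar qW V
    with hs
  have hlim : Filter.Tendsto (fun n : ℕ => 4 * (2 : ℝ) ^ (-(n * δ)) + 2 * s / (n * δ ^ 2))
      Filter.atTop (nhds 0) := by
    have hn : Filter.Tendsto (fun n : ℕ => (n : ℝ)) Filter.atTop Filter.atTop :=
      tendsto_natCast_atTop_atTop
    have e1 : Filter.Tendsto (fun n : ℕ => (2 : ℝ) ^ (-(n * δ))) Filter.atTop (nhds 0) := by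
      have : ∀ n : ℕ, (2 : ℝ) ^ (-(n * δ)) = ((2 : ℝ) ^ (-δ)) ^ n := fun n => by
        rw [← Real.rpow_natCast, ← Real.rpow_mul (by norm_num)]
        ring_nf
      simp only [this]
      exact tendsto_pow_atTop_nhds_zero_of_lt_one (by positivity)
        (Real.rpow_lt_one_of_one_lt_of_neg (by norm_num) (by linarith))
    have e2 : Filter.Tendsto (fun n : ℕ => 2 * s / (n * δ ^ 2)) Filter.atTop (nhds 0) :=
      (hn.atTop_mul_const (by positivity)).const_div_atTop _
    simpa using (e1.const_mul 4).add e2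
  obtain ⟨N₁, hN₁⟩ := Filter.eventually_atTop.mp (hlim.eventually (ge_mem_nhds hε))
  obtain ⟨N₂, hN₂⟩ := exists_nat_gt (1 / δ)
  refine ⟨max N₁ N₂ + 1, fun n hn => ?_⟩
  have hn0 : 0 < n := by omega
  have hn0' : (0 : ℝ) < n := by exact_mod_cast hn0
  obtain ⟨enc, dec, he, hd, hb⟩ := exists_enc_dec_nfold hqWp hVp hTp hUp h₁ h₂ hδ0 hn0
  refine ⟨NC n (R + 5 * δ), ?_, enc, dec, he, hd, ?_⟩
  · have h1 := logb_NC_le (n := n) (C := R + 5 * δ) (by positivity)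
    have h2 : (1 : ℝ) ≤ δ * n := by
      have : (N₂ : ℝ) ≤ n := by exact_mod_cast (by omega : N₂ ≤ n)
      rw [div_lt_iff₀ hδ0] at hN₂
      nlinarith
    rw [one_div, inv_mul_le_iff₀ hn0']
    have : R + ε = R + 6 * δ := by rw [hδ]; ring
    rw [this]
    linarith
  · have h1 := hN₁ n (by omega)
    rw [tvDist]
    simp only [hout, hXZ] at hb
    have h2 := Finset.sum_nonneg (s := Finset.univ) (f := fun
      w : (Fin n → X) × (Fin n → Y) × (Fin n → Z) =>
      |∏ i, p (w.1 i, w.2.1 i, w.2.2 i) - (NC n C : ℝ)⁻¹ * ∑ k, ∑ m,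
        (∏ i, push p (fun v => (v.1, v.2.2)) (w.1 i, w.2.2 i)) * enc k w.1 m * dec k w.2.2 m w.2.1|)
      (fun w _ => abs_nonneg _)
    linarith

end Direct

section Entropy

set_option linter.unusedSectionVars false

variable {α β γ : Type*} [Fintype α] [Fintype β] [Fintype γ]

lemma Hent_eq_sum_negMulLog (p : α → ℝ) : Hent p = (∑ a, Real.negMulLog (p a)) / Real.log 2 := by
  rw [Hent, Finset.sum_div]
  exact Finset.sum_congr rfl fun a _ => by rw [Real.negMulLog, Real.logb]; ring

lemma continuous_Hent : Continuous (Hent : (α → ℝ) → ℝ) := by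
  have : (Hent : (α → ℝ) → ℝ) = fun p => (∑ a, Real.negMulLog (p a)) / Real.log 2 :=
    funext Hent_eq_sum_negMulLog
  rw [this]
  have := Real.continuous_negMulLog
  fun_prop

lemma continuous_push_apply {δ : Type*} (f : α → δ) (b : δ) :
    Continuous (fun p : α → ℝ => push p f b) := by
  refine continuous_finsetSum _ fun a _ => ?_
  split_ifs <;> fun_prop

lemma continuous_push (f : α → β) : Continuous (fun p : α → ℝ => push p f) :=
  continuous_pi fun b => continuous_push_apply f b

lemma Hent_comp_equiv (p : α → ℝ) (e : β ≃ α) : Hent (fun b => p (e b)) = Hent p :=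
  Equiv.sum_comp e (fun a => -(p a * Real.logb 2 (p a)))

/-- Gibbs' inequality. -/
lemma Hent_le_sum_mul_neg_logb {p q : α → ℝ} (hp : IsPMF p) (hq : ∀ a, 0 ≤ q a)
    (hq1 : ∑ a, q a ≤ 1) (hpq : ∀ a, 0 < p a → 0 < q a) :
    Hent p ≤ ∑ a, p a * -Real.logb 2 (q a) := by
  have hl : 0 < Real.log 2 := Real.log_pos (by norm_num)
  have h : ∀ a, p a * Real.log (q a) - p a * Real.log (p a) ≤ q a - p a := by
    intro a
    rcases (hp.1 a).eq_or_lt with h | h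
    · simp [← h, hq a]
    · have h1 := Real.log_le_sub_one_of_pos (div_pos (hpq a h) h)
      rw [Real.log_div (hpq a h).ne' h.ne'] at h1
      have h2 := mul_le_mul_of_nonneg_left h1 h.le
      have h3 : p a * (q a / p a - 1) = q a - p a := by field_simp
      linarith
  have h1 := Finset.sum_le_sum fun a (_ : a ∈ Finset.univ) => h a
  rw [Finset.sum_sub_distrib, Finset.sum_sub_distrib, hp.2] at h1
  have h2 : ∑ a, p a * -Real.logb 2 (q a) = (-∑ a, p a * Real.log (q a)) / Real.log 2 := by
    rw [← Finset.sum_neg_distrib, Finset.sum_div]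
    exact Finset.sum_congr rfl fun a _ => by rw [Real.logb]; ring
  rw [h2, Hent_eq_sum_negMulLog]
  refine div_le_div_of_nonneg_right ?_ hl.le
  have h3 : ∑ a, Real.negMulLog (p a) = -∑ a, p a * Real.log (p a) := by
    rw [← Finset.sum_neg_distrib]
    exact Finset.sum_congr rfl fun a _ => by rw [Real.negMulLog]; ring
  rw [h3]
  linarith

lemma Hent_le_logb_card {p : α → ℝ} (hp : IsPMF p) : Hent p ≤ Real.logb 2 (Fintype.card α) := by
  have hne : Nonempty α := by
    by_contra h
    rw [not_nonempty_iff] at h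
    have := hp.2
    simp at this
  have hc : (0 : ℝ) < Fintype.card α := by exact_mod_cast Fintype.card_pos
  refine (Hent_le_sum_mul_neg_logb hp (q := fun _ => (Fintype.card α : ℝ)⁻¹)
    (fun _ => by positivity) ?_ (fun _ _ => by positivity)).trans_eq ?_
  · simp [hc.ne']
  · rw [← Finset.sum_mul, hp.2, Real.logb_inv]
    ring

lemma Hent_push_comp_le {p : α → ℝ} (hp : ∀ a, 0 ≤ p a) (f : α → β) (g : β → γ) :
    Hent (push p (fun a => g (f a))) ≤ Hent (push p f) := by
  rw [Hent_push, Hent_push]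
  refine Finset.sum_le_sum fun a _ => ?_
  rcases (hp a).eq_or_lt with h | h
  · simp [← h]
  · refine mul_le_mul_of_nonneg_left (neg_le_neg ?_) h.le
    exact Real.logb_le_logb_of_le (by norm_num) (h.trans_le (le_push hp f a))
      (push_le_push_comp hp f g (f a))

lemma Hent_le_add {r : α × β → ℝ} (hr : IsPMF r) :
    Hent r ≤ Hent (push r Prod.fst) + Hent (push r Prod.snd) := by
  have h0 : ∀ x, 0 < r x → 0 < push r Prod.fst x.1 ∧ 0 < push r Prod.snd x.2 := fun x hx =>
    ⟨hx.trans_le (le_push hr.1 Prod.fst x), hx.trans_le (le_push hr.1 Prod.snd x)⟩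
  refine (Hent_le_sum_mul_neg_logb hr
    (q := fun x => push r Prod.fst x.1 * push r Prod.snd x.2)
    (fun x => mul_nonneg (push_nonneg hr.1 _ _) (push_nonneg hr.1 _ _)) (le_of_eq ?_)
    (fun x hx => mul_pos (h0 x hx).1 (h0 x hx).2)).trans_eq ?_
  · simp [Fintype.sum_prod_type, ← Finset.mul_sum, (hr.push _).2]
  · rw [Hent_push, Hent_push, ← Finset.sum_add_distrib]
    refine Finset.sum_congr rfl fun x _ => ?_
    rcases (hr.1 x).eq_or_lt with h | h
    · simp [← h]
    · rw [Real.logb_mul (h0 x h).1.ne' (h0 x h).2.ne']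
      ring

/-- Conditional entropy is subadditive. -/
lemma Hent_sub_le_sum {n : ℕ} {r : (Fin n → α) × β → ℝ} (hr : IsPMF r) :
    Hent r - Hent (push r Prod.snd)
      ≤ ∑ t, (Hent (push r (fun u => (u.1 t, u.2))) - Hent (push r Prod.snd)) := by
  set b := push r Prod.snd with hb
  have hbp : IsPMF b := hr.push _
  set s : Fin n → α × β → ℝ := fun t => push r (fun u => (u.1 t, u.2)) with hs
  have hs0 : ∀ t x, 0 ≤ s t x := fun t => push_nonneg hr.1 _
  have h0 : ∀ x, 0 < r x → 0 < b x.2 ∧ ∀ t, 0 < s t (x.1 t, x.2) := fun x hx =>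
    ⟨hx.trans_le (le_push hr.1 Prod.snd x),
      fun t => hx.trans_le (le_push hr.1 (fun u => (u.1 t, u.2)) x)⟩
  have hsb : ∀ t y, ∑ a, s t (a, y) = b y := by
    intro t y
    rw [← push_snd, hs, push_push]
  have hG := Hent_le_sum_mul_neg_logb hr
    (q := fun x => b x.2 * ∏ t, (s t (x.1 t, x.2) / b x.2))
    (fun x => mul_nonneg (hbp.1 _) (Finset.prod_nonneg fun t _ =>
      div_nonneg (hs0 _ _) (hbp.1 _))) ?_
    (fun x hx => mul_pos (h0 x hx).1 (Finset.prod_pos fun t _ =>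
      div_pos ((h0 x hx).2 t) (h0 x hx).1))
  · rw [← sub_nonneg]
    rw [← sub_nonneg] at hG
    refine hG.trans_eq ?_
    have e : ∑ x, r x * -Real.logb 2 (b x.2 * ∏ t, (s t (x.1 t, x.2) / b x.2))
        = Hent b + ∑ t, (Hent (s t) - Hent b) := by
      have : ∀ t, Hent (s t) - Hent b
          = ∑ x, r x * (-Real.logb 2 (s t (x.1 t, x.2)) + Real.logb 2 (b x.2)) := by
        intro t
        rw [hs, hb]
        dsimp only
        rw [Hent_push, Hent_push, ← Finset.sum_sub_distrib]
        exact Finset.sum_congr rfl fun x _ => by ring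
      simp only [this]
      rw [Finset.sum_comm, hb, Hent_push, ← Finset.sum_add_distrib]
      refine Finset.sum_congr rfl fun x _ => ?_
      rw [← Finset.mul_sum, ← mul_add]
      rcases (hr.1 x).eq_or_lt with h | h
      · simp [← h]
      · congr 1
        obtain ⟨h1, h2⟩ := h0 x h
        rw [← hb, Real.logb_mul h1.ne' (Finset.prod_ne_zero_iff.mpr fun t _ =>
          (div_pos (h2 t) h1).ne'), Real.logb_prod _ _ (fun t _ => (div_pos (h2 t) h1).ne'),
          neg_add, ← Finset.sum_neg_distrib]
        congr 1
        refine Finset.sum_congr rfl fun t _ => ?_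
        rw [Real.logb_div (h2 t).ne' h1.ne']
        ring
    rw [e]
    ring
  · rw [Fintype.sum_prod_type, Finset.sum_comm, ← hbp.2]
    refine Finset.sum_le_sum fun y _ => ?_
    dsimp only
    rw [← Finset.mul_sum, sum_prod_eq_prod_sum (fun t a => s t (a, y) / b y)]
    simp only [← Finset.sum_div, hsb]
    refine mul_le_of_le_one_right (hbp.1 y) (Finset.prod_le_one (fun t _ => ?_) fun t _ => ?_)
    · exact div_nonneg (hbp.1 y) (hbp.1 y)
    · exact div_self_le_one _

lemma Hent_prod {n : ℕ} {p : α → ℝ} (hp : IsPMF p) :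
    Hent (fun c : Fin n → α => ∏ i, p (c i)) = n * Hent p := by
  have h : Hent (fun c : Fin n → α => ∏ i, p (c i))
      = iidExp p (fun c : Fin n → α => ∑ i, -Real.logb 2 (p (c i))) := by
    refine Finset.sum_congr rfl fun c _ => ?_
    by_cases h0 : ∏ i, p (c i) = 0
    · simp [h0]
    · rw [Real.logb_prod _ _ (fun i _ => Finset.prod_ne_zero_iff.mp h0 i (Finset.mem_univ i))]
      simp only [Finset.sum_neg_distrib]
      ring
  rw [h, iidExp_sum, Finset.sum_congr rfl
    (fun i _ => iidExp_eval hp i (fun a => -Real.logb 2 (p a)))]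
  simp [Hent]

lemma Hent_uniform_mul {p : α → ℝ} (hp : IsPMF p) {K : ℕ} (hK : 0 < K) :
    Hent (fun u : Fin K × α => (K : ℝ)⁻¹ * p u.2) = Real.logb 2 K + Hent p := by
  have hK' : (0 : ℝ) < K := by exact_mod_cast hK
  have h : ∀ a, -((K : ℝ)⁻¹ * p a * Real.logb 2 ((K : ℝ)⁻¹ * p a))
      = (K : ℝ)⁻¹ * (p a * Real.logb 2 K + -(p a * Real.logb 2 (p a))) := by
    intro a
    by_cases h0 : p a = 0
    · simp [h0]
    · rw [Real.logb_mul (by positivity) h0, Real.logb_inv]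
      ring
  simp only [Hent, Fintype.sum_prod_type, h]
  rw [Finset.sum_const, Finset.card_univ, Fintype.card_fin, nsmul_eq_mul, ← Finset.mul_sum,
    mul_inv_cancel_left₀ hK'.ne', Finset.sum_add_distrib, ← Finset.sum_mul, hp.2, one_mul]

lemma Hent_markov {r : α × β × γ → ℝ} (hr : ∀ x, 0 ≤ r x) (hm : Markov r) :
    Hent r + Hent (push r (fun x => x.2.1))
      = Hent (push r (fun x => (x.1, x.2.1))) + Hent (push r Prod.snd) := by
  rw [Hent_push, Hent_push, Hent_push, Hent, ← Finset.sum_add_distrib, ← Finset.sum_add_distrib]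
  refine Finset.sum_congr rfl fun x _ => ?_
  rcases (hr x).eq_or_lt with h | h
  · simp [← h]
  · have h1 := h.trans_le (le_push hr (fun x => x.2.1) x)
    have h2 := h.trans_le (le_push hr (fun x => (x.1, x.2.1)) x)
    have h3 := h.trans_le (le_push hr Prod.snd x)
    have h4 := congrArg (Real.logb 2) (hm x.1 x.2.1 x.2.2)
    change Real.logb 2 (r x * push r (fun x => x.2.1) x.2.1)
      = Real.logb 2 (push r (fun x => (x.1, x.2.1)) (x.1, x.2.1) * push r Prod.snd x.2) at h4
    rw [Real.logb_mul h.ne' h1.ne', Real.logb_mul h2.ne' h3.ne'] at h4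
    linear_combination -(r x) * h4

lemma negMulLog_add_le {a b : ℝ} (ha : 0 ≤ a) (hb : 0 ≤ b) :
    Real.negMulLog (a + b) ≤ Real.negMulLog a + Real.negMulLog b := by
  rcases ha.eq_or_lt with rfl | ha
  · simp
  rcases hb.eq_or_lt with rfl | hb
  · simp
  have h1 := Real.log_le_log ha (by linarith : a ≤ a + b)
  have h2 := Real.log_le_log hb (by linarith : b ≤ a + b)
  simp only [Real.negMulLog]
  nlinarith

lemma negMulLog_le_add {a b : ℝ} (ha : 0 ≤ a) (hb : 0 ≤ b) (hab : a + b ≤ 1) :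
    Real.negMulLog a ≤ Real.negMulLog (a + b) + b := by
  rcases ha.eq_or_lt with rfl | ha
  · have := Real.negMulLog_nonneg (x := 0 + b) (by linarith) hab
    simp only [Real.negMulLog_zero]
    linarith
  have h0 : 0 < a + b := by linarith
  have h1 := Real.log_le_sub_one_of_pos (div_pos h0 ha)
  rw [Real.log_div h0.ne' ha.ne'] at h1
  have h2 := mul_le_mul_of_nonneg_left h1 ha.le
  have h3 : a * ((a + b) / a - 1) = b := by field_simp; ring
  have h4 := mul_nonneg hb (neg_nonneg.mpr (Real.log_nonpos h0.le hab))
  simp only [Real.negMulLog]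
  nlinarith

lemma sum_negMulLog_le {e : α → ℝ} (he : ∀ a, 0 ≤ e a) {δ : ℝ} (hδ : ∑ a, e a = δ) :
    ∑ a, Real.negMulLog (e a) ≤ δ * Real.log (Fintype.card α) + (1 - δ) := by
  have hδ0 : 0 ≤ δ := hδ ▸ Finset.sum_nonneg fun a _ => he a
  rcases hδ0.eq_or_lt with h | h
  · have h0 : ∀ a, e a = 0 := fun a =>
      (Finset.sum_eq_zero_iff_of_nonneg fun a _ => he a).mp (hδ.trans h.symm) a (Finset.mem_univ a)
    simp [h0, ← h]
  · have hl : 0 < Real.log 2 := Real.log_pos (by norm_num)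
    have hp : IsPMF fun a => e a / δ :=
      ⟨fun a => div_nonneg (he a) hδ0, by rw [← Finset.sum_div, hδ, div_self h.ne']⟩
    have h1 := Hent_le_logb_card hp
    rw [Hent_eq_sum_negMulLog, Real.logb, div_le_div_iff_of_pos_right hl] at h1
    have h2 : ∀ a, Real.negMulLog (e a)
        = e a / δ * Real.negMulLog δ + δ * Real.negMulLog (e a / δ) := fun a => by
      rw [← Real.negMulLog_mul, mul_div_cancel₀ _ h.ne']
    have h3 : Real.negMulLog δ ≤ 1 - δ := by
      have := Real.one_sub_inv_le_log_of_pos h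
      have := mul_le_mul_of_nonneg_left this hδ0
      rw [mul_sub, mul_inv_cancel₀ h.ne'] at this
      rw [Real.negMulLog]
      linarith
    rw [Finset.sum_congr rfl fun a _ => h2 a, Finset.sum_add_distrib, ← Finset.sum_mul, hp.2,
      ← Finset.mul_sum]
    have := mul_le_mul_of_nonneg_left h1 hδ0
    linarith

/-- Continuity of entropy with respect to the total variation distance. -/
lemma Hent_le_of_tvDist_le {p q : α → ℝ} (hp : IsPMF p) (hq : IsPMF q) {ε : ℝ}
    (h : tvDist p q ≤ ε) :
    Hent p ≤ Hent q + ε * Real.logb 2 (Fintype.card α) + 1 / Real.log 2 := by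
  have hl : 0 < Real.log 2 := Real.log_pos (by norm_num)
  set c : α → ℝ := fun a => min (p a) (q a) with hc
  have hc0 : ∀ a, 0 ≤ c a := fun a => le_min (hp.1 a) (hq.1 a)
  have hcp : ∀ a, c a ≤ p a := fun a => min_le_left _ _
  have hcq : ∀ a, c a ≤ q a := fun a => min_le_right _ _
  set δ := tvDist p q with hδ
  have habs : ∀ a, |p a - q a| = p a + q a - 2 * c a := fun a => by
    rcases le_total (p a) (q a) with h | h
    · rw [abs_of_nonpos (by linarith), hc]
      simp only [min_eq_left h]
      ring
    · rw [abs_of_nonneg (by linarith), hc]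
      simp only [min_eq_right h]
      ring
  have hsc : ∑ a, c a = 1 - δ := by
    rw [hδ, tvDist, Finset.sum_congr rfl fun a _ => habs a, Finset.sum_sub_distrib,
      Finset.sum_add_distrib, hp.2, hq.2, ← Finset.mul_sum]
    ring
  have he : ∑ a, (p a - c a) = δ := by rw [Finset.sum_sub_distrib, hp.2, hsc]; ring
  have hf : ∑ a, (q a - c a) = δ := by rw [Finset.sum_sub_distrib, hq.2, hsc]; ring
  have h1 : ∑ a, Real.negMulLog (p a)
      ≤ ∑ a, (Real.negMulLog (c a) + Real.negMulLog (p a - c a)) :=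
    Finset.sum_le_sum fun a _ => by
      simpa using negMulLog_add_le (hc0 a) (sub_nonneg.mpr (hcp a))
  have h2 : ∑ a, Real.negMulLog (c a) ≤ ∑ a, (Real.negMulLog (q a) + (q a - c a)) :=
    Finset.sum_le_sum fun a _ => by
      have h1 : q a ≤ 1 := hq.2 ▸ Finset.single_le_sum (fun a _ => hq.1 a) (Finset.mem_univ a)
      simpa using negMulLog_le_add (hc0 a) (sub_nonneg.mpr (hcq a)) (by linarith)
  have h3 := sum_negMulLog_le (fun a => sub_nonneg.mpr (hcp a)) he
  rw [Finset.sum_add_distrib] at h1 h2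
  rw [hf] at h2
  have h4 : δ * Real.log (Fintype.card α) ≤ ε * Real.log (Fintype.card α) :=
    mul_le_mul_of_nonneg_right h (Real.log_natCast_nonneg _)
  rw [Hent_eq_sum_negMulLog, Hent_eq_sum_negMulLog, Real.logb, mul_div_assoc', ← add_div,
    ← add_div]
  exact div_le_div_of_nonneg_right (by linarith) hl.le

end Entropy

section AuxiliaryReduction

set_option linter.unusedSectionVars false

variable {V α β W : Type*} [Fintype V] [Fintype α] [Fintype β] [Fintype W]

lemma push_id (r : V → ℝ) : push r id = r :=
  funext fun v => push_injective r Function.injective_id v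

lemma push_smul {δ : Type*} (c : ℝ) (r : V → ℝ) (f : V → δ) : push (c • r) f = c • push r f := by
  funext b
  simp only [push, Pi.smul_apply, smul_eq_mul, Finset.mul_sum, mul_ite, mul_zero]

lemma Hent_smul (c : ℝ) (r : V → ℝ) :
    Hent (c • r) = c * Hent r - c * Real.logb 2 c * ∑ v, r v := by
  simp only [Hent, Finset.mul_sum, ← Finset.sum_sub_distrib]
  refine Finset.sum_congr rfl fun v _ => ?_
  simp only [Pi.smul_apply, smul_eq_mul]
  by_cases hc : c = 0
  · simp [hc]
  by_cases hr : r v = 0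
  · simp [hr]
  rw [Real.logb_mul hc hr]
  ring

/-- The entropy of `f` minus the entropy of `g` under the measure `r`. -/
def entDiff (f : V → α) (g : V → β) (r : V → ℝ) : ℝ :=
  Hent (push r f) - Hent (push r g)

lemma entDiff_smul (f : V → α) (g : V → β) (c : ℝ) (r : V → ℝ) :
    entDiff f g (c • r) = c * entDiff f g r := by
  rw [entDiff, push_smul, push_smul, Hent_smul, Hent_smul, sum_push, sum_push, entDiff]
  ring

lemma continuous_entDiff (f : V → α) (g : V → β) : Continuous (entDiff f g) :=
  (continuous_Hent.comp (continuous_push f)).sub (continuous_Hent.comp (continuous_push g))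

lemma push_fst_prodMk {δ : Type*} (q : W × V → ℝ) (f : V → δ) (w : W) (b : δ) :
    push q (fun u => (u.1, f u.2)) (w, b) = push (fun v => q (w, v)) f b := by
  rw [push, Fintype.sum_prod_type, Finset.sum_eq_single w]
  · simp [push]
  · intro w' _ h
    simp [h]
  · simp

lemma entDiff_prodMk (q : W × V → ℝ) (f : V → α) (g : V → β) :
    entDiff (fun u => (u.1, f u.2)) (fun u => (u.1, g u.2)) q
      = ∑ w, entDiff f g (fun v => q (w, v)) := by
  simp only [entDiff, Hent, Fintype.sum_prod_type, push_fst_prodMk, Finset.sum_sub_distrib]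

/-- A conic version of Carathéodory's theorem for the graph of a pair of homogeneous functions. -/
lemma exists_fin_family_eq {S : Set (V → ℝ)} (hS0 : 0 ∈ S)
    (hS : ∀ c : ℝ, 0 ≤ c → ∀ r ∈ S, c • r ∈ S) (hSn : ∀ r ∈ S, ∀ v, 0 ≤ r v)
    {h₁ h₂ : (V → ℝ) → ℝ} (hh₁ : ∀ (c : ℝ) r, h₁ (c • r) = c * h₁ r)
    (hh₂ : ∀ (c : ℝ) r, h₂ (c • r) = c * h₂ r)
    {g : W → V → ℝ} (hg : ∀ w, g w ∈ S) (hg1 : ∑ w, ∑ v, g w v = 1) :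
    ∃ g' : Fin (Fintype.card V ^ 2) → V → ℝ, (∀ i, g' i ∈ S) ∧ ∑ i, g' i = ∑ w, g w ∧
      ∑ i, h₁ (g' i) = ∑ w, h₁ (g w) ∧ ∑ i, h₂ (g' i) = ∑ w, h₂ (g w) := by
  have h₁0 : h₁ 0 = 0 := by simpa using hh₁ 0 0
  have h₂0 : h₂ 0 = 0 := by simpa using hh₂ 0 0
  set φ : (V → ℝ) → (V → ℝ) × ℝ × ℝ := fun r => (r, h₁ r, h₂ r) with hφ
  have hφs : ∀ (c : ℝ) r, φ (c • r) = c • φ r := fun c r => by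
    simp [hφ, hh₁, hh₂]
  have hφ0 : φ 0 = 0 := by simpa using hφs 0 0
  set s : Set ((V → ℝ) × ℝ × ℝ) := φ '' {r | r ∈ S ∧ ∑ v, r v = 1} with hs
  set m : W → ℝ := fun w => ∑ v, g w v with hm
  have hm0 : ∀ w, 0 ≤ m w := fun w => Finset.sum_nonneg fun v _ => hSn _ (hg w) v
  have hgm : ∀ w, m w = 0 → g w = 0 := fun w h => funext fun v =>
    (Finset.sum_eq_zero_iff_of_nonneg fun v _ => hSn _ (hg w) v).mp h v (Finset.mem_univ v)
  have hmem : ∑ w, φ (g w) ∈ convexHull ℝ s := by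
    have e1 : ∑ w, φ (g w) = ∑ w with m w ≠ 0, m w • φ ((m w)⁻¹ • g w) := by
      rw [Finset.sum_filter]
      refine Finset.sum_congr rfl fun w _ => ?_
      split_ifs with h
      · rw [← hφs, smul_inv_smul₀ h]
      · rw [hgm w (not_not.mp h), hφ0]
    rw [e1]
    refine (convex_convexHull ℝ s).sum_mem (fun w _ => hm0 w) ?_ fun w hw => ?_
    · rw [Finset.sum_filter_ne_zero]
      exact hg1
    · have hw' : m w ≠ 0 := (Finset.mem_filter.mp hw).2
      refine subset_convexHull ℝ s ⟨_, ⟨hS _ (inv_nonneg.mpr (hm0 w)) _ (hg w), ?_⟩, rfl⟩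
      simp only [Pi.smul_apply, smul_eq_mul, ← Finset.mul_sum]
      exact inv_mul_cancel₀ hw'
  obtain ⟨ι, _, z, c, hz, hind, hc0, hc1, hsum⟩ := eq_pos_convex_span_of_mem_convexHull hmem
  have hr : ∀ i, ∃ r, (r ∈ S ∧ ∑ v, r v = 1) ∧ φ r = z i := fun i => hz ⟨i, rfl⟩
  choose r hr hrz using hr
  have hcard : Fintype.card ι ≤ Fintype.card V ^ 2 := by
    rcases Nat.lt_or_ge 1 (Fintype.card V) with hV | hV
    · have hlin : LinearIndependent ℝ z := by
        rw [Fintype.linearIndependent_iff]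
        intro a ha i
        have h0 : ∑ i, a i = 0 := by
          have := congrArg (fun y : (V → ℝ) × ℝ × ℝ => ∑ v, y.1 v) ha
          simp only [Prod.fst_sum, Finset.sum_apply, Prod.smul_fst, Pi.smul_apply, smul_eq_mul,
            Prod.fst_zero, Pi.zero_apply, Finset.sum_const_zero] at this
          rw [Finset.sum_comm] at this
          rw [← this]
          refine Finset.sum_congr rfl fun i _ => ?_
          rw [← Finset.mul_sum, ← hrz, (hr i).2, mul_one]
        exact affineIndependent_iff.mp hind Finset.univ a h0 ha i (Finset.mem_univ i)
      have := hlin.fintype_card_le_finrank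
      rw [Module.finrank_prod, Module.finrank_prod, Module.finrank_pi, Module.finrank_self] at this
      nlinarith
    · have hle : Fintype.card ι ≤ 1 := by
        rw [Fintype.card_le_one_iff]
        intro i j
        apply hind.injective
        rw [← hrz, ← hrz]
        congr 1
        have : Subsingleton V := Fintype.card_le_one_iff_subsingleton.mp hV
        funext v
        have hi := (hr i).2
        have hj := (hr j).2
        rw [Fintype.sum_subsingleton _ v] at hi hj
        rw [hi, hj]
      refine hle.trans (Nat.one_le_pow _ _ ?_)
      rw [Fintype.card_pos_iff]
      by_contra h
      rw [not_nonempty_iff] at h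
      simp [hm] at hg1
  obtain ⟨e⟩ : Nonempty (ι ↪ Fin (Fintype.card V ^ 2)) :=
    Function.Embedding.nonempty_of_card_le (by simpa using hcard)
  set g' : Fin (Fintype.card V ^ 2) → V → ℝ := Function.extend e (fun i => c i • r i) 0 with hg'
  have hge : ∀ i, g' (e i) = c i • r i := fun i => e.injective.extend_apply _ _ _
  have hg0 : ∀ k, k ∉ Set.range e → g' k = 0 := fun k hk =>
    Function.extend_apply' _ _ _ (by simpa using hk)
  have hφsum : ∑ k, φ (g' k) = ∑ w, φ (g w) := by
    rw [← hsum]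
    refine (Fintype.sum_of_injective e e.injective _ _ (fun k hk => ?_) fun i => ?_).symm
    · rw [hg0 k hk, hφ0]
    · rw [hge, hφs, hrz]
  refine ⟨g', fun k => ?_, ?_, ?_, ?_⟩
  · by_cases hk : k ∈ Set.range e
    · obtain ⟨i, rfl⟩ := hk
      rw [hge]
      exact hS _ (hc0 i).le _ (hr i).1
    · rw [hg0 k hk]
      exact hS0
  · simpa [hφ, Prod.fst_sum] using congrArg Prod.fst hφsum
  · simpa [hφ, Prod.fst_sum, Prod.snd_sum] using congrArg (fun y => y.2.1) hφsum
  · simpa [hφ, Prod.fst_sum, Prod.snd_sum] using congrArg (fun y => y.2.2) hφsum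

end AuxiliaryReduction

section SingleLetter

set_option linter.unusedSectionVars false

variable {W X Y Z : Type*} [Fintype W] [Fintype X] [Fintype Y] [Fintype Z]

/-- Measures on `X × Y × Z` under which `Z` given `X` is distributed as under `p`, and `X` and `Y`
are conditionally independent given `Z`. -/
def admissible (p : X × Y × Z → ℝ) : Set (X × Y × Z → ℝ) :=
  {r | (∀ v, 0 ≤ r v) ∧
    (∀ x z, push r (fun v => (v.1, v.2.2)) (x, z) * push p Prod.fst x
      = push p (fun v => (v.1, v.2.2)) (x, z) * push r Prod.fst x) ∧
    ∀ x y z, r (x, y, z) * push r (fun v => v.2.2) z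
      = push r (fun v => (v.1, v.2.2)) (x, z) * push r Prod.snd (y, z)}

lemma isClosed_admissible (p : X × Y × Z → ℝ) : IsClosed (admissible p) := by
  refine IsClosed.inter ?_ (IsClosed.inter ?_ ?_)
  · change IsClosed {r : X × Y × Z → ℝ | ∀ v, 0 ≤ r v}
    simp only [Set.ofPred_forall]
    exact isClosed_iInter fun v => isClosed_le continuous_const (continuous_apply v)
  · change IsClosed {r : X × Y × Z → ℝ | ∀ x z, _ = _}
    simp only [Set.ofPred_forall]
    exact isClosed_iInter fun x => isClosed_iInter fun z =>
      isClosed_eq ((continuous_push_apply _ _).mul continuous_const)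
        (continuous_const.mul (continuous_push_apply _ _))
  · change IsClosed {r : X × Y × Z → ℝ | ∀ x y z, _ = _}
    simp only [Set.ofPred_forall]
    exact isClosed_iInter fun x => isClosed_iInter fun y => isClosed_iInter fun z =>
      isClosed_eq ((continuous_apply _).mul (continuous_push_apply _ _))
        ((continuous_push_apply _ _).mul (continuous_push_apply _ _))

lemma zero_mem_admissible (p : X × Y × Z → ℝ) : 0 ∈ admissible p := by
  refine ⟨fun v => le_rfl, fun x z => ?_, fun x y z => ?_⟩ <;> simp [push]

lemma smul_mem_admissible {p : X × Y × Z → ℝ} {c : ℝ} (hc : 0 ≤ c) {r : X × Y × Z → ℝ}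
    (hr : r ∈ admissible p) : c • r ∈ admissible p := by
  refine ⟨fun v => mul_nonneg hc (hr.1 v), fun x z => ?_, fun x y z => ?_⟩
  · simp only [push_smul, Pi.smul_apply, smul_eq_mul]
    linear_combination c * hr.2.1 x z
  · simp only [push_smul, Pi.smul_apply, smul_eq_mul]
    linear_combination c ^ 2 * hr.2.2 x y z

/-- Joint distributions with an auxiliary variable all of whose slices are admissible. -/
def admissibleJoint (W : Type*) [Fintype W] (p : X × Y × Z → ℝ) : Set (W × X × Y × Z → ℝ) :=
  {q | IsPMF q ∧ ∀ w, (fun v => q (w, v)) ∈ admissible p}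

lemma isCompact_admissibleJoint (p : X × Y × Z → ℝ) : IsCompact (admissibleJoint W p) := by
  refine (isCompact_stdSimplex ℝ (W × X × Y × Z)).inter_right
    (t := {q | ∀ w, (fun v => q (w, v)) ∈ admissible p}) ?_
  simp only [Set.ofPred_forall]
  exact isClosed_iInter fun w => (isClosed_admissible p).preimage
    (continuous_pi fun v => continuous_apply (w, v))

lemma push_snd_eq_sum (q : W × X × Y × Z → ℝ) :
    push q Prod.snd = ∑ w, fun v => q (w, v) := by
  funext v
  rw [push_snd, Finset.sum_apply]

/-- `H(X, Z | W) - H(Z | W)`. -/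
def auxEnt₁ : (W × X × Y × Z → ℝ) → ℝ :=
  entDiff (fun u => (u.1, (u.2.1, u.2.2.2))) (fun u => (u.1, u.2.2.2))

/-- `H(X, Y, Z | W) - H(Z | W)`. -/
def auxEnt₂ : (W × X × Y × Z → ℝ) → ℝ :=
  entDiff (fun u => (u.1, id u.2)) (fun u => (u.1, u.2.2.2))

lemma exists_admissibleJoint_fin {p : X × Y × Z → ℝ} {q : W × X × Y × Z → ℝ}
    (hq : q ∈ admissibleJoint W p) :
    ∃ q' ∈ admissibleJoint (Fin ((Fintype.card X * Fintype.card Y * Fintype.card Z) ^ 2)) p,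
      push q' Prod.snd = push q Prod.snd ∧ auxEnt₁ q' = auxEnt₁ q ∧ auxEnt₂ q' = auxEnt₂ q := by
  obtain ⟨g, hg, hs, h1, h2⟩ := exists_fin_family_eq (zero_mem_admissible p)
    (fun c hc r hr => smul_mem_admissible hc hr) (fun r hr => hr.1)
    (entDiff_smul (fun v => (v.1, v.2.2)) (fun v => v.2.2)) (entDiff_smul id (fun v => v.2.2))
    (g := fun w v => q (w, v)) hq.2 (by rw [← Fintype.sum_prod_type']; exact hq.1.2)
  have hc : Fintype.card (X × Y × Z) = Fintype.card X * Fintype.card Y * Fintype.card Z := by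
    rw [Fintype.card_prod, Fintype.card_prod, mul_assoc]
  rw [← hc]
  have hsnd : push (fun u => g u.1 u.2) Prod.snd = push q Prod.snd := by
    rw [push_snd_eq_sum, push_snd_eq_sum, ← hs]
  refine ⟨fun u => g u.1 u.2, ⟨⟨fun u => (hg _).1 _, ?_⟩, hg⟩, hsnd, ?_, ?_⟩
  · rw [← sum_push _ Prod.snd, hsnd, sum_push, hq.1.2]
  · rw [auxEnt₁, auxEnt₁, entDiff_prodMk _ (fun v : X × Y × Z => (v.1, v.2.2)) (fun v => v.2.2),
      entDiff_prodMk _ (fun v : X × Y × Z => (v.1, v.2.2)) (fun v => v.2.2)]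
    exact h1
  · rw [auxEnt₂, auxEnt₂, entDiff_prodMk _ id (fun v : X × Y × Z => v.2.2),
      entDiff_prodMk _ id (fun v : X × Y × Z => v.2.2)]
    exact h2

lemma exists_admissibleJoint_of_approx {p : X × Y × Z → ℝ} {a b : ℝ}
    (h : ∀ ε : ℝ, 0 < ε → ∃ q ∈ admissibleJoint W p,
      ∑ v, |push q Prod.snd v - p v| ≤ ε ∧ a - ε ≤ auxEnt₁ q ∧ b - ε ≤ auxEnt₂ q) :
    ∃ q ∈ admissibleJoint W p, push q Prod.snd = p ∧ a ≤ auxEnt₁ q ∧ b ≤ auxEnt₂ q := by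
  set F : (W × X × Y × Z → ℝ) → ℝ := fun q =>
    ∑ v, |push q Prod.snd v - p v| + max 0 (a - auxEnt₁ q) + max 0 (b - auxEnt₂ q) with hF
  have hcont : Continuous F := by
    have h1 : Continuous (auxEnt₁ : (W × X × Y × Z → ℝ) → ℝ) := continuous_entDiff _ _
    have h2 : Continuous (auxEnt₂ : (W × X × Y × Z → ℝ) → ℝ) := continuous_entDiff _ _
    have h3 : ∀ v, Continuous fun q : W × X × Y × Z → ℝ => push q Prod.snd v := fun v =>
      continuous_push_apply _ v
    fun_prop
  have happ : ∀ ε : ℝ, 0 < ε → ∃ q ∈ admissibleJoint W p, F q ≤ 3 * ε := fun ε hε => by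
    obtain ⟨q, hq, h1, h2, h3⟩ := h ε hε
    refine ⟨q, hq, ?_⟩
    have h4 : max 0 (a - auxEnt₁ q) ≤ ε := max_le hε.le (by linarith)
    have h5 : max 0 (b - auxEnt₂ q) ≤ ε := max_le hε.le (by linarith)
    simp only [hF]
    linarith
  obtain ⟨q₀, hq₀, -⟩ := happ 1 one_pos
  obtain ⟨q, hq, hmin⟩ := (isCompact_admissibleJoint p).exists_isMinOn ⟨q₀, hq₀⟩
    hcont.continuousOn
  have hF0 : F q ≤ 0 := by
    refine le_of_forall_pos_le_add fun ε hε => ?_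
    obtain ⟨q', hq', h'⟩ := happ (ε / 3) (by positivity)
    have := hmin hq'
    simp only [Set.mem_ofPred_eq] at this
    linarith
  have hn : ∀ v, 0 ≤ |push q Prod.snd v - p v| := fun v => abs_nonneg _
  have h1 := Finset.sum_nonneg fun v (_ : v ∈ Finset.univ) => hn v
  have h2 := le_max_left 0 (a - auxEnt₁ q)
  have h3 := le_max_left 0 (b - auxEnt₂ q)
  have h4 := le_max_right 0 (a - auxEnt₁ q)
  have h5 := le_max_right 0 (b - auxEnt₂ q)
  simp only [hF] at hF0
  refine ⟨q, hq, funext fun v => ?_, by linarith, by linarith⟩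
  have h6 := Finset.single_le_sum (fun v _ => hn v) (Finset.mem_univ v)
  have h7 := abs_nonpos_iff.mp (by linarith : |push q Prod.snd v - p v| ≤ 0)
  linarith

lemma push_prodMk_eq {δ : Type*} (q : W × X × Y × Z → ℝ) (f : X × Y × Z → δ) (w : W) (b : δ) :
    push (fun v => q (w, v)) f b = push q (fun u => (u.1, f u.2)) (w, b) :=
  (push_fst_prodMk q f w b).symm

lemma markov_of_admissibleJoint {p : X × Y × Z → ℝ} {q : W × X × Y × Z → ℝ}
    (hq : q ∈ admissibleJoint W p) (hqp : push q Prod.snd = p) :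
    Markov (push q (fun u => (u.2.2.2, u.2.1, u.1))) ∧
      Markov (push q (fun u => (u.2.1, (u.2.2.2, u.1), u.2.2.1))) := by
  constructor
  · intro z x w
    have h := (hq.2 w).2.1 x z
    simp only [push_prodMk_eq] at h
    rw [← hqp, push_push, push_push] at h
    simp only [push_push]
    rw [push_congr (g := fun u : W × X × Y × Z => (u.1, u.2.1, u.2.2.2)) (c := (w, x, z))
        (fun u => by simp; tauto),
      push_congr (f := fun u : W × X × Y × Z => (u.2.2.2, u.2.1)) (b := (z, x))
        (g := fun u : W × X × Y × Z => (u.2.1, u.2.2.2)) (c := (x, z)) (fun u => by simp; tauto),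
      push_congr (f := fun u : W × X × Y × Z => (u.2.1, u.1)) (b := (x, w))
        (g := fun u : W × X × Y × Z => (u.1, u.2.1)) (c := (w, x)) (fun u => by simp; tauto)]
    exact h
  · rintro x ⟨z, w⟩ y
    have h := (hq.2 w).2.2 x y z
    simp only [push_prodMk_eq] at h
    simp only [push_push]
    rw [push_congr (g := id) (c := (w, x, y, z)) (fun u => by simp [Prod.ext_iff]; tauto),
      push_congr (f := fun u : W × X × Y × Z => (u.2.1, (u.2.2.2, u.1)))
        (b := (x, (z, w))) (g := fun u : W × X × Y × Z => (u.1, u.2.1, u.2.2.2))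
        (c := (w, x, z)) (fun u => by simp; tauto),
      push_congr (f := fun u : W × X × Y × Z => (u.2.2.2, u.1)) (b := (z, w))
        (g := fun u : W × X × Y × Z => (u.1, u.2.2.2)) (c := (w, z)) (fun u => by simp; tauto),
      push_congr (f := fun u : W × X × Y × Z => ((u.2.2.2, u.1), u.2.2.1)) (b := ((z, w), y))
        (g := fun u : W × X × Y × Z => (u.1, u.2.2)) (c := (w, (y, z)))
        (fun u => by simp [Prod.ext_iff]; tauto), push_id]
    exact h

lemma Hent_push_equiv {α β γ : Type*} [Fintype α] [Fintype β] [Fintype γ] (q : α → ℝ) (f : α → β)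
    (e : β ≃ γ) : Hent (push q (fun a => e (f a))) = Hent (push q f) := by
  rw [← Hent_comp_equiv _ e]
  congr 1
  funext b
  exact push_congr fun a => e.apply_eq_iff_eq

lemma I2_sub_I2_eq₁ {q : W × X × Y × Z → ℝ} (hq : IsPMF q)
    (hm : Markov (push q (fun u => (u.2.2.2, u.2.1, u.1)))) :
    I2 (push q (fun u => (u.2.1, u.1))) - I2 (push q (fun u => (u.1, u.2.2.2)))
      = entDiff (fun u => (u.2.1, u.2.2.2)) (fun u => u.2.2.2) q - auxEnt₁ q := by
  have h := Hent_markov (push_nonneg hq.1 _) hm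
  simp only [push_push] at h
  have e1 := Hent_push_equiv q (fun u => (u.2.2.2, u.2.1)) (Equiv.prodComm _ _)
  have e2 := Hent_push_equiv q (fun u => (u.2.2.2, u.2.1, u.1))
    (((Equiv.prodAssoc _ _ _).symm.trans (Equiv.prodComm _ _)).trans
      (Equiv.prodCongr (Equiv.refl _) (Equiv.prodComm _ _)))
  simp only [Equiv.prodComm_apply, Prod.swap_prod_mk] at e1
  change Hent (push q (fun u => (u.1, u.2.1, u.2.2.2))) = _ at e2
  simp only [I2, push_push, entDiff, auxEnt₁]
  rw [e1, e2]
  linarith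

lemma I2_sub_I2_eq₂ (q : W × X × Y × Z → ℝ) :
    I2 (push q (fun u => (u.2, u.1))) - I2 (push q (fun u => (u.1, u.2.2.2)))
      = entDiff Prod.snd (fun u => u.2.2.2) q - auxEnt₂ q := by
  have e1 := Hent_push_equiv q (fun u => (u.1, u.2)) (Equiv.prodComm _ _)
  simp only [Equiv.prodComm_apply, Prod.swap_prod_mk] at e1
  simp only [I2, push_push, entDiff, auxEnt₂]
  rw [e1]
  simp only [id]
  ring

end SingleLetter

section CodeDistribution

lemma push_eq_sum_of_equiv {α β γ : Type*} [Fintype α] [Fintype β] [Fintype γ] (p : α → ℝ)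
    {f : α → β} (e : β × γ ≃ α) (h : ∀ u, f (e u) = u.1) (b : β) :
    push p f b = ∑ c, p (e (b, c)) := by
  rw [← push_fst (fun u => p (e u)), push, push, ← e.sum_comp]
  simp only [h]

lemma push_mul_mul {α β γ δ : Type*} [Fintype α] [Fintype β] (a : α → ℝ) (b : β → ℝ) (f : α → γ)
    (g : β → δ) (c : γ) (d : δ) :
    push (fun v : α × β => a v.1 * b v.2) (fun v => (f v.1, g v.2)) (c, d)
      = push a f c * push b g d := by
  simp only [push, Finset.sum_mul_sum, Fintype.sum_prod_type, Prod.mk.injEq]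
  refine Finset.sum_congr rfl fun x _ => Finset.sum_congr rfl fun y _ => ?_
  by_cases h1 : f x = c <;> by_cases h2 : g y = d <;> simp [h1, h2]

lemma push_prod_eval {A : Type*} [Fintype A] {n : ℕ} {p : A → ℝ} (hp : IsPMF p) (t : Fin n) :
    push (fun c : Fin n → A => ∏ i, p (c i)) (fun c => c t) = p := by
  funext a
  have h := iidExp_eval hp t (fun b => if b = a then 1 else 0)
  simpa [iidExp, push] using h

variable {X Y Z : Type*} [Fintype X] [Fintype Y] [Fintype Z]

lemma mem_admissible_of_factor {p : X × Y × Z → ℝ} (hp : ∀ v, 0 ≤ p v) {A : X → ℝ}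
    (hA : ∀ x, 0 ≤ A x) {D : Z → Y → ℝ} (hD : ∀ z, IsPMF (D z)) :
    (fun v : X × Y × Z => push p (fun v => (v.1, v.2.2)) (v.1, v.2.2) * A v.1 * D v.2.2 v.2.1)
      ∈ admissible p := by
  set T := push p (fun v => (v.1, v.2.2)) with hT
  set r : X × Y × Z → ℝ := fun v => T (v.1, v.2.2) * A v.1 * D v.2.2 v.2.1 with hr
  have hT0 : ∀ v, 0 ≤ T v := push_nonneg hp _
  have h1 : ∀ x z, push r (fun v => (v.1, v.2.2)) (x, z) = T (x, z) * A x := by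
    intro x z
    rw [push_eq_sum_of_equiv r (γ := Y)
      ⟨fun u => (u.1.1, u.2, u.1.2), fun v => ((v.1, v.2.2), v.2.1), fun _ => rfl, fun _ => rfl⟩
      (fun _ => rfl)]
    simp only [hr, Equiv.coe_fn_mk]
    rw [← Finset.mul_sum, (hD z).2, mul_one]
  have h2 : ∀ y z, push r Prod.snd (y, z) = (∑ x, T (x, z) * A x) * D z y := by
    intro y z
    rw [push_snd, Finset.sum_mul]
  have h3 : ∀ z, push r (fun v => v.2.2) z = ∑ x, T (x, z) * A x := by
    intro z
    have := push_snd (push r (fun v => (v.1, v.2.2))) z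
    rw [push_push] at this
    rw [this]
    exact Finset.sum_congr rfl fun x _ => h1 x z
  refine ⟨fun v => mul_nonneg (mul_nonneg (hT0 _) (hA _)) ((hD _).1 _), fun x z => ?_,
    fun x y z => ?_⟩
  · have h4 : push r Prod.fst x = push p Prod.fst x * A x := by
      have := push_fst (push r (fun v => (v.1, v.2.2))) x
      rw [push_push] at this
      rw [this]
      have h5 := push_fst T x
      rw [hT, push_push] at h5
      rw [h5, Finset.sum_mul]
      exact Finset.sum_congr rfl fun z _ => h1 x z
    rw [h1, h4]
    ring
  · rw [h1, h2, h3]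
    simp only [hr]
    ring

variable {K n : ℕ} {M : Type*} [Fintype M]

/-- Joint distribution of common randomness, message and sequences induced by a code. -/
def codeJoint (p : X × Y × Z → ℝ) (enc : Fin K → (Fin n → X) → M → ℝ)
    (dec : Fin K → (Fin n → Z) → M → (Fin n → Y) → ℝ)
    (u : (Fin K × M × (Fin n → Z)) × (Fin n → X) × (Fin n → Y)) : ℝ :=
  (K : ℝ)⁻¹ * (∏ i, push p (fun v => (v.1, v.2.2)) (u.2.1 i, u.1.2.2 i)) * enc u.1.1 u.2.1 u.1.2.1
    * dec u.1.1 u.1.2.2 u.1.2.1 u.2.2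

variable {p : X × Y × Z → ℝ} {enc : Fin K → (Fin n → X) → M → ℝ}
  {dec : Fin K → (Fin n → Z) → M → (Fin n → Y) → ℝ}

lemma push_codeJoint_source (henc : ∀ k x, IsPMF (enc k x)) (hdec : ∀ k z m, IsPMF (dec k z m))
    (k : Fin K) (c : Fin n → X × Z) :
    push (codeJoint p enc dec) (fun u => (u.1.1, fun i => (u.2.1 i, u.1.2.2 i))) (k, c)
      = (K : ℝ)⁻¹ * ∏ i, push p (fun v => (v.1, v.2.2)) (c i) := by
  rw [push_eq_sum_of_equiv _ (γ := M × (Fin n → Y))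
    ⟨fun u => ((u.1.1, u.2.1, fun i => (u.1.2 i).2), fun i => (u.1.2 i).1, u.2.2),
      fun u => ((u.1.1, fun i => (u.2.1 i, u.1.2.2 i)), (u.1.2.1, u.2.2)), fun _ => rfl,
      fun _ => rfl⟩ (fun _ => rfl), Fintype.sum_prod_type]
  simp only [codeJoint, Equiv.coe_fn_mk, ← Finset.mul_sum, (hdec _ _ _).2, mul_one, (henc _ _).2,
    Prod.mk.eta]

lemma codeJoint_isPMF (hp : IsPMF p) (hK : 0 < K) (henc : ∀ k x, IsPMF (enc k x))
    (hdec : ∀ k z m, IsPMF (dec k z m)) : IsPMF (codeJoint p enc dec) := by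
  refine ⟨fun u => mul_nonneg (mul_nonneg (mul_nonneg (by positivity)
    (Finset.prod_nonneg fun i _ => push_nonneg hp.1 _ _)) ((henc _ _).1 _)) ((hdec _ _ _).1 _), ?_⟩
  have hK' : (K : ℝ) ≠ 0 := by exact_mod_cast hK.ne'
  rw [← sum_push _ (fun u => (u.1.1, fun i => (u.2.1 i, u.1.2.2 i))), Fintype.sum_prod_type]
  simp only [push_codeJoint_source henc hdec, ← Finset.mul_sum]
  rw [(prod_isPMF (J := Fin n) (hp.push (fun v => (v.1, v.2.2)))).2]
  simp [hK']

lemma push_codeJoint_seq (v : (Fin n → X) × (Fin n → Y) × (Fin n → Z)) :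
    push (codeJoint p enc dec) (fun u => (u.2.1, u.2.2, u.1.2.2)) v
      = (K : ℝ)⁻¹ * ∑ k, ∑ m, (∏ i, push p (fun v => (v.1, v.2.2)) (v.1 i, v.2.2 i))
          * enc k v.1 m * dec k v.2.2 m v.2.1 := by
  rw [push_eq_sum_of_equiv _ (γ := Fin K × M)
    ⟨fun u => ((u.2.1, u.2.2, u.1.2.2), u.1.1, u.1.2.1),
      fun u => ((u.2.1, u.2.2, u.1.2.2), (u.1.1, u.1.2.1)), fun _ => rfl, fun _ => rfl⟩
    (fun _ => rfl), Fintype.sum_prod_type]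
  simp only [codeJoint, Equiv.coe_fn_mk, Finset.mul_sum, mul_assoc]

/-- Splits off the letter at position `t`: the auxiliary variable consists of the common
randomness, the message and the side information at the other positions. -/
def splitLetter (z₀ : Z) (t : Fin n) (u : (Fin K × M × (Fin n → Z)) × (Fin n → X) × (Fin n → Y)) :
    (Fin K × M × (Fin n → Z)) × X × Y × Z :=
  ((u.1.1, u.1.2.1, Function.update u.1.2.2 t z₀), u.2.1 t, u.2.2 t, u.1.2.2 t)

lemma push_splitLetter_mem_admissible (hp : IsPMF p) (henc : ∀ k x, IsPMF (enc k x))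
    (hdec : ∀ k z m, IsPMF (dec k z m)) (z₀ : Z) (t : Fin n) (w : Fin K × M × (Fin n → Z)) :
    (fun v => push (codeJoint p enc dec) (splitLetter z₀ t) (w, v)) ∈ admissible p := by
  obtain ⟨k, m, s⟩ := w
  by_cases hs : s t = z₀
  · set T := push p (fun v => (v.1, v.2.2)) with hT
    have hT0 : ∀ v, 0 ≤ T v := push_nonneg hp.1 _
    set A : (Fin n → X) → ℝ := fun x =>
      (K : ℝ)⁻¹ * (∏ i ∈ Finset.univ.erase t, T (x i, s i)) * enc k x m with hA
    have hA0 : ∀ x, 0 ≤ A x := fun x => mul_nonneg (mul_nonneg (by positivity)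
      (Finset.prod_nonneg fun i _ => hT0 _)) ((henc _ _).1 _)
    convert mem_admissible_of_factor hp.1 (push_nonneg hA0 (fun x => x t))
      (fun z => (hdec k (Function.update s t z) m).push (fun y => y t)) using 1
    funext v
    obtain ⟨x, y, z⟩ := v
    have h1 : push (codeJoint p enc dec) (splitLetter z₀ t) ((k, m, s), x, y, z)
        = push (codeJoint p enc dec) (fun u => (u.1, (u.2.1 t, u.2.2 t)))
          ((k, m, Function.update s t z), (x, y)) := by
      refine push_congr fun u => ?_
      simp only [splitLetter, Prod.ext_iff]
      constructor
      · rintro ⟨⟨h1, h2, h3⟩, h4, h5, h6⟩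
        refine ⟨⟨h1, h2, ?_⟩, h4, h5⟩
        rw [← h3, ← h6]
        simp
      · rintro ⟨⟨h1, h2, h3⟩, h4, h5⟩
        refine ⟨⟨h1, h2, ?_⟩, h4, h5, ?_⟩
        · rw [h3, ← hs]
          simp
        · rw [h3]
          simp
    have h2 : push (fun x : Fin n → X => (K : ℝ)⁻¹ * (∏ i, T (x i, Function.update s t z i))
        * enc k x m) (fun x => x t) x = T (x, z) * push A (fun x => x t) x := by
      simp only [push, Finset.mul_sum]
      refine Finset.sum_congr rfl fun x' _ => ?_
      split_ifs with h
      · have h3 : ∏ i ∈ Finset.univ.erase t, T (x' i, Function.update s t z i)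
            = ∏ i ∈ Finset.univ.erase t, T (x' i, s i) :=
          Finset.prod_congr rfl fun i hi => by
            rw [Function.update_of_ne (Finset.ne_of_mem_erase hi)]
        rw [← Finset.mul_prod_erase _ _ (Finset.mem_univ t), h3, Function.update_self, h]
        simp only [hA]
        ring
      · simp
    rw [h1, push_fst_prodMk _ (fun v : (Fin n → X) × (Fin n → Y) => (v.1 t, v.2 t)), ← h2,
      ← push_mul_mul]
    rfl
  · convert zero_mem_admissible p using 1
    funext v
    refine Finset.sum_eq_zero fun u _ => if_neg fun h => hs ?_
    have := congrArg (fun a => a.1.2.2 t) h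
    simpa [splitLetter] using this.symm

/-- The time-shared single-letter distribution of a code. -/
def letterJoint (p : X × Y × Z → ℝ) (enc : Fin K → (Fin n → X) → M → ℝ)
    (dec : Fin K → (Fin n → Z) → M → (Fin n → Y) → ℝ) (z₀ : Z)
    (u : (Fin n × Fin K × M × (Fin n → Z)) × X × Y × Z) : ℝ :=
  (n : ℝ)⁻¹ * push (codeJoint p enc dec) (splitLetter z₀ u.1.1) (u.1.2, u.2)

lemma push_letterJoint_snd (z₀ : Z) (v : X × Y × Z) :
    push (letterJoint p enc dec z₀) Prod.snd v
      = (n : ℝ)⁻¹ * ∑ t : Fin n, push (codeJoint p enc dec)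
          (fun u => (u.2.1 t, u.2.2 t, u.1.2.2 t)) v := by
  rw [push_snd, Fintype.sum_prod_type, Finset.mul_sum]
  refine Finset.sum_congr rfl fun t _ => ?_
  have h := push_snd (push (codeJoint p enc dec) (splitLetter z₀ t)) v
  rw [push_push] at h
  simp only [splitLetter] at h
  rw [h, Finset.mul_sum]
  rfl

lemma letterJoint_mem (hp : IsPMF p) (hK : 0 < K) (hn : 0 < n) (henc : ∀ k x, IsPMF (enc k x))
    (hdec : ∀ k z m, IsPMF (dec k z m)) (z₀ : Z) :
    letterJoint p enc dec z₀ ∈ admissibleJoint (Fin n × Fin K × M × (Fin n → Z)) p := by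
  have hP := codeJoint_isPMF hp hK henc hdec
  have hn' : (n : ℝ) ≠ 0 := by exact_mod_cast hn.ne'
  refine ⟨⟨fun u => mul_nonneg (by positivity) (push_nonneg hP.1 _ _), ?_⟩, fun w => ?_⟩
  · rw [← sum_push _ Prod.snd]
    simp only [push_letterJoint_snd]
    rw [← Finset.mul_sum, Finset.sum_comm]
    simp only [sum_push, hP.2]
    simp [hn']
  · exact smul_mem_admissible (by positivity : (0 : ℝ) ≤ (n : ℝ)⁻¹)
      (push_splitLetter_mem_admissible hp henc hdec z₀ w.1 w.2)

lemma sum_abs_push_letterJoint_snd_sub_le (hp : IsPMF p) (hn : 0 < n) (z₀ : Z) {ε : ℝ}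
    (h : tvDist (fun w : (Fin n → X) × (Fin n → Y) × (Fin n → Z) =>
        ∏ i, p (w.1 i, w.2.1 i, w.2.2 i))
      (push (codeJoint p enc dec) (fun u => (u.2.1, u.2.2, u.1.2.2))) ≤ ε) :
    ∑ v, |push (letterJoint p enc dec z₀) Prod.snd v - p v| ≤ 2 * ε := by
  set Q := push (codeJoint p enc dec) (fun u => (u.2.1, u.2.2, u.1.2.2)) with hQ
  set P : (Fin n → X) × (Fin n → Y) × (Fin n → Z) → ℝ :=
    fun w => ∏ i, p (w.1 i, w.2.1 i, w.2.2 i) with hP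
  have hn' : (n : ℝ) ≠ 0 := by exact_mod_cast hn.ne'
  have h1 : ∀ t : Fin n, push P (fun w => (w.1 t, w.2.1 t, w.2.2 t)) = p := by
    intro t
    rw [← push_prod_eval hp t]
    funext v
    rw [push, push, ← (zipEquiv n X Y Z).sum_comp]
    rfl
  have h2 : ∀ t : Fin n, ∑ v, |push Q (fun w => (w.1 t, w.2.1 t, w.2.2 t)) v - p v| ≤ 2 * ε := by
    intro t
    have h3 := sum_abs_push_sub_le Q P (fun w => (w.1 t, w.2.1 t, w.2.2 t))
    rw [h1] at h3
    refine h3.trans ?_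
    simp only [abs_sub_comm (Q _)]
    rw [tvDist] at h
    linarith
  calc ∑ v, |push (letterJoint p enc dec z₀) Prod.snd v - p v|
      = ∑ v, |(n : ℝ)⁻¹ * ∑ t : Fin n,
          (push Q (fun w => (w.1 t, w.2.1 t, w.2.2 t)) v - p v)| := by
        refine Finset.sum_congr rfl fun v _ => ?_
        rw [push_letterJoint_snd, Finset.sum_sub_distrib, mul_sub]
        simp only [hQ, push_push]
        simp [hn']
    _ ≤ ∑ v, (n : ℝ)⁻¹ * ∑ t : Fin n, |push Q (fun w => (w.1 t, w.2.1 t, w.2.2 t)) v - p v| := by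
        refine Finset.sum_le_sum fun v _ => ?_
        rw [abs_mul, abs_of_nonneg (by positivity : (0 : ℝ) ≤ (n : ℝ)⁻¹)]
        exact mul_le_mul_of_nonneg_left (Finset.abs_sum_le_sum_abs _ _) (by positivity)
    _ = (n : ℝ)⁻¹ * ∑ t : Fin n, ∑ v, |push Q (fun w => (w.1 t, w.2.1 t, w.2.2 t)) v - p v| := by
        rw [← Finset.mul_sum, Finset.sum_comm]
    _ ≤ (n : ℝ)⁻¹ * ∑ t : Fin n, 2 * ε :=
        mul_le_mul_of_nonneg_left (Finset.sum_le_sum fun t _ => h2 t) (by positivity)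
    _ = 2 * ε := by simp [hn']

lemma push_prod_map {A B : Type*} [Fintype A] (r : A → ℝ) (g : A → B) :
    push (fun c : Fin n → A => ∏ i, r (c i)) (fun c i => g (c i))
      = fun b => ∏ i, push r g (b i) := by
  funext b
  simp only [push]
  rw [← sum_prod_eq_prod_sum]
  refine Finset.sum_congr rfl fun c _ => ?_
  simp only [Finset.prod_ite_zero, Finset.mem_univ, forall_const, funext_iff]

lemma Hent_sub_le_entDiff_letterJoint {A B : Type*} [Fintype A] [Fintype B] (hp : IsPMF p)
    (hK : 0 < K) (hn : 0 < n) (henc : ∀ k x, IsPMF (enc k x)) (hdec : ∀ k z m, IsPMF (dec k z m))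
    (z₀ : Z) (f : X × Y → A) (F : X × Y × Z → B) (h : B → A × Z)
    (hF : ∀ x y z, h (F (x, y, z)) = (f (x, y), z)) :
    Hent (push (codeJoint p enc dec) (fun u => ((fun i => f (u.2.1 i, u.2.2 i)), u.1)))
        - Hent (push (codeJoint p enc dec) Prod.fst)
      ≤ n * entDiff (fun u => (u.1, F u.2)) (fun u => (u.1, u.2.2.2))
          (letterJoint p enc dec z₀) := by
  set P := codeJoint p enc dec with hP
  have hPp : IsPMF P := codeJoint_isPMF hp hK henc hdec
  have hn' : (n : ℝ) ≠ 0 := by exact_mod_cast hn.ne'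
  have h1 : n * entDiff (fun u => (u.1, F u.2)) (fun u => (u.1, u.2.2.2))
      (letterJoint p enc dec z₀) = ∑ t : Fin n, entDiff (fun u => (u.1, F u.2))
        (fun u => (u.1, u.2.2.2)) (push P (splitLetter z₀ t)) := by
    rw [entDiff_prodMk _ F (fun v => v.2.2), Fintype.sum_prod_type, Finset.mul_sum]
    refine Finset.sum_congr rfl fun t _ => ?_
    rw [entDiff_prodMk _ F (fun v => v.2.2), Finset.mul_sum]
    refine Finset.sum_congr rfl fun w _ => ?_
    have := entDiff_smul F (fun v => v.2.2) (n : ℝ)⁻¹ (fun v => push P (splitLetter z₀ t) (w, v))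
    change n * entDiff F (fun v => v.2.2)
      ((n : ℝ)⁻¹ • fun v => push P (splitLetter z₀ t) (w, v)) = _
    rw [this, mul_inv_cancel_left₀ hn']
  have h2 := Hent_sub_le_sum (hPp.push (fun u => ((fun i => f (u.2.1 i, u.2.2 i)), u.1)))
  simp only [push_push] at h2
  rw [h1]
  refine h2.trans (Finset.sum_le_sum fun t _ => ?_)
  simp only [entDiff, push_push]
  refine sub_le_sub ?_ ?_
  · have h3 := Hent_push_comp_le hPp.1
      (fun u => ((splitLetter z₀ t u).1, F (splitLetter z₀ t u).2))
      (fun b => ((h b.2).1, b.1.1, b.1.2.1, Function.update b.1.2.2 t (h b.2).2))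
    simpa [splitLetter, hF] using h3
  · have h3 := Hent_push_comp_le hPp.1 Prod.fst
      (fun b : Fin K × M × (Fin n → Z) => ((b.1, b.2.1, Function.update b.2.2 t z₀), b.2.2 t))
    exact h3

lemma Hent_push_codeJoint_fst_le (hp : IsPMF p) (hK : 0 < K) (henc : ∀ k x, IsPMF (enc k x))
    (hdec : ∀ k z m, IsPMF (dec k z m)) :
    Hent (push (codeJoint p enc dec) Prod.fst)
      ≤ Real.logb 2 K + Real.logb 2 (Fintype.card M) + n * Hent (push p (fun v => v.2.2)) := by
  set P := codeJoint p enc dec with hP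
  have hPp : IsPMF P := codeJoint_isPMF hp hK henc hdec
  have hM : Nonempty M := by
    by_contra h
    rw [not_nonempty_iff] at h
    simpa using hPp.2
  have h1 := Hent_le_add (hPp.push (fun u => ((u.1.1, u.1.2.1), u.1.2.2)))
  have h2 := Hent_push_comp_le hPp.1 (fun u => ((u.1.1, u.1.2.1), u.1.2.2))
    (fun b => (b.1.1, b.1.2, b.2))
  have h3 := Hent_le_logb_card (hPp.push (fun u => (u.1.1, u.1.2.1)))
  have h4 : push P (fun u => u.1.2.2) = fun c => ∏ i, push p (fun v => v.2.2) (c i) := by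
    have hK' : (K : ℝ) ≠ 0 := by exact_mod_cast hK.ne'
    have h5 : push P (fun u i => (u.2.1 i, u.1.2.2 i))
        = fun c => ∏ i, push p (fun v => (v.1, v.2.2)) (c i) := by
      funext c
      have h := push_snd (push P (fun u => (u.1.1, fun i => (u.2.1 i, u.1.2.2 i)))) c
      simp only [push_push, hP, push_codeJoint_source henc hdec] at h
      rw [h]
      simp [hK']
    have h6 := push_prod_map (n := n) (push p (fun v => (v.1, v.2.2))) Prod.snd
    rw [← h5] at h6
    simpa only [push_push] using h6
  simp only [push_push] at h1
  rw [h4, Hent_prod (hp.push _)] at h1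
  rw [Fintype.card_prod, Fintype.card_fin, Nat.cast_mul, Real.logb_mul (by positivity)
    (by simp)] at h3
  exact h2.trans (by linarith)

lemma le_Hent_push_codeJoint_fst (hp : IsPMF p) (hK : 0 < K) (henc : ∀ k x, IsPMF (enc k x))
    (hdec : ∀ k z m, IsPMF (dec k z m)) :
    Real.logb 2 K + n * Hent (push p (fun v => (v.1, v.2.2)))
      ≤ Hent (push (codeJoint p enc dec) (fun u => (u.2.1, u.1))) := by
  set P := codeJoint p enc dec with hP
  have hPp : IsPMF P := codeJoint_isPMF hp hK henc hdec
  have h2 := Hent_push_comp_le hPp.1 (fun u => (u.2.1, u.1))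
    (fun b => (b.2.1, fun i => (b.1 i, b.2.2.2 i)))
  have h3 : push P (fun u => (u.1.1, fun i => (u.2.1 i, u.1.2.2 i)))
      = fun u => (K : ℝ)⁻¹ * ∏ i, push p (fun v => (v.1, v.2.2)) (u.2 i) :=
    funext fun u => push_codeJoint_source henc hdec u.1 u.2
  rw [h3, Hent_uniform_mul (prod_isPMF (hp.push _)) hK, Hent_prod (hp.push _)] at h2
  exact h2

lemma le_Hent_push_codeJoint (hp : IsPMF p) (hK : 0 < K) (henc : ∀ k x, IsPMF (enc k x))
    (hdec : ∀ k z m, IsPMF (dec k z m)) {ε : ℝ}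
    (h : tvDist (fun w : (Fin n → X) × (Fin n → Y) × (Fin n → Z) =>
        ∏ i, p (w.1 i, w.2.1 i, w.2.2 i))
      (push (codeJoint p enc dec) (fun u => (u.2.1, u.2.2, u.1.2.2))) ≤ ε) :
    n * Hent p - n * ε * Real.logb 2 (Fintype.card (X × Y × Z)) - 1 / Real.log 2
      ≤ Hent (push (codeJoint p enc dec) (fun u => ((fun i => (u.2.1 i, u.2.2 i)), u.1))) := by
  set P := codeJoint p enc dec with hP
  have hPp : IsPMF P := codeJoint_isPMF hp hK henc hdec
  set S : (Fin n → X) × (Fin n → Y) × (Fin n → Z) → ℝ :=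
    fun w => ∏ i, p (w.1 i, w.2.1 i, w.2.2 i) with hS
  have hSp : IsPMF S := by
    refine ⟨fun w => Finset.prod_nonneg fun i _ => hp.1 _, ?_⟩
    rw [← (zipEquiv n X Y Z).sum_comp]
    exact (prod_isPMF (J := Fin n) hp).2
  have hSe : Hent S = n * Hent p := by
    rw [← Hent_comp_equiv S (zipEquiv n X Y Z)]
    exact Hent_prod hp
  have h1 := Hent_le_of_tvDist_le hSp (hPp.push _) h
  have h2 := Hent_push_comp_le hPp.1 (fun u => ((fun i => (u.2.1 i, u.2.2 i)), u.1))
    (fun b => ((fun i => (b.1 i).1), (fun i => (b.1 i).2), b.2.2.2))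
  have h3 : Real.logb 2 (Fintype.card ((Fin n → X) × (Fin n → Y) × (Fin n → Z)))
      = n * Real.logb 2 (Fintype.card (X × Y × Z)) := by
    rw [← Fintype.card_congr (zipEquiv n X Y Z), Fintype.card_fun, Fintype.card_fin, Nat.cast_pow,
      Real.logb_pow]
  rw [hSe, h3] at h1
  refine le_trans ?_ h2
  linarith

end CodeDistribution

section Converse

variable {X Y Z : Type} [Fintype X] [Fintype Y] [Fintype Z] {p : X × Y × Z → ℝ} {R C : ℝ}

lemma exists_approx_of_rsAchievable (hp : IsPMF p) (hC : 0 ≤ C) (h : RsAchievable p R C) {ε : ℝ}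
    (hε : 0 < ε) :
    ∃ q ∈ admissibleJoint (Fin ((Fintype.card X * Fintype.card Y * Fintype.card Z) ^ 2)) p,
      ∑ v, |push q Prod.snd v - p v| ≤ ε ∧
      entDiff (fun v => (v.1, v.2.2)) (fun v => v.2.2) p - R - ε ≤ auxEnt₁ q ∧
      entDiff id (fun v => v.2.2) p - (R + C) - ε ≤ auxEnt₂ q := by
  have hne : Nonempty (X × Y × Z) := by
    by_contra h0
    rw [not_nonempty_iff] at h0
    simpa using hp.2
  obtain ⟨-, -, z₀⟩ := hne.some
  set L := Real.logb 2 (Fintype.card (X × Y × Z)) with hL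
  have hL0 : 0 ≤ L := Real.logb_nonneg (by norm_num) (by exact_mod_cast Fintype.card_pos)
  set δ := ε / (L + 3) with hδ
  have hδ0 : 0 < δ := by positivity
  have hδε : δ * (L + 3) = ε := div_mul_cancel₀ _ (by positivity)
  have hδL : 0 ≤ δ * L := by positivity
  obtain ⟨N, hN⟩ := h δ hδ0
  set c := 1 + 1 / Real.log 2 with hc
  set n := max (N + 1) ⌈c / δ⌉₊ with hn
  have hn0 : 0 < n := (Nat.succ_pos N).trans_le (le_max_left _ _)
  have hn0' : (0 : ℝ) < n := by exact_mod_cast hn0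
  have hcn : c ≤ n * δ := by
    rw [← div_le_iff₀ hδ0]
    exact (Nat.le_ceil _).trans (by exact_mod_cast le_max_right _ _)
  obtain ⟨Θ, hΘ, enc, dec, henc, hdec, htv⟩ := hN n ((Nat.le_succ N).trans (le_max_left _ _))
  have hK := NC_pos n C
  have hlogΘ : Real.logb 2 Θ ≤ n * (R + δ) := by
    rw [one_div, inv_mul_le_iff₀ hn0'] at hΘ
    exact hΘ
  have htv' : tvDist (fun w : (Fin n → X) × (Fin n → Y) × (Fin n → Z) =>
        ∏ i, p (w.1 i, w.2.1 i, w.2.2 i))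
      (push (codeJoint p enc dec) (fun u => (u.2.1, u.2.2, u.1.2.2))) ≤ δ := by
    convert htv using 2
    exact funext push_codeJoint_seq
  have hB := Hent_push_codeJoint_fst_le hp hK henc hdec
  rw [Fintype.card_fin] at hB
  have hB1 := Hent_sub_le_entDiff_letterJoint hp hK hn0 henc hdec z₀ Prod.fst
    (fun v => (v.1, v.2.2)) id (fun _ _ _ => rfl)
  have hB2 := Hent_sub_le_entDiff_letterJoint hp hK hn0 henc hdec z₀ id id
    (fun v => ((v.1, v.2.1), v.2.2)) (fun _ _ _ => rfl)
  have hE1 := le_Hent_push_codeJoint_fst hp hK henc hdec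
  have hE2 := le_Hent_push_codeJoint hp hK henc hdec htv'
  have hNC := logb_NC_le (n := n) hC
  obtain ⟨q, hq, hq0, hq1, hq2⟩ := exists_admissibleJoint_fin
    (letterJoint_mem hp hK hn0 henc hdec z₀)
  refine ⟨q, hq, ?_, ?_, ?_⟩
  · rw [hq0]
    refine (sum_abs_push_letterJoint_snd_sub_le hp hn0 z₀ htv').trans ?_
    linarith
  · rw [hq1]
    refine le_of_mul_le_mul_left ?_ hn0'
    refine le_trans ?_ hB1
    have := mul_le_mul_of_nonneg_left (by linarith : δ ≤ ε) hn0'.le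
    simp only [entDiff]
    linarith
  · rw [hq2]
    refine le_of_mul_le_mul_left ?_ hn0'
    refine le_trans ?_ hB2
    have := mul_le_mul_of_nonneg_left (by linarith : δ * L + 2 * δ ≤ ε) hn0'.le
    simp only [entDiff, push_id, id]
    linarith

theorem exists_auxiliary_of_rsAchievable (hp : IsPMF p) (hC : 0 ≤ C) (h : RsAchievable p R C) :
    ∃ q : Fin ((Fintype.card X * Fintype.card Y * Fintype.card Z) ^ 2) × (X × Y × Z) → ℝ,
      IsPMF q ∧
      (∀ v : X × Y × Z, push q Prod.snd v = p v) ∧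
      Markov (push q (fun u => (u.2.2.2, u.2.1, u.1))) ∧
      Markov (push q (fun u => (u.2.1, (u.2.2.2, u.1), u.2.2.1))) ∧
      I2 (push q (fun u => (u.2.1, u.1))) - I2 (push q (fun u => (u.1, u.2.2.2))) ≤ R ∧
      I2 (push q (fun u => (u.2, u.1))) - I2 (push q (fun u => (u.1, u.2.2.2))) ≤ R + C := by
  obtain ⟨q, hq, hqp, h1, h2⟩ := exists_admissibleJoint_of_approx
    fun ε hε => exists_approx_of_rsAchievable hp hC h hε
  obtain ⟨hm₁, hm₂⟩ := markov_of_admissibleJoint hq hqp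
  refine ⟨q, hq.1, fun v => congrFun hqp v, hm₁, hm₂, ?_, ?_⟩
  · rw [I2_sub_I2_eq₁ hq.1 hm₁]
    rw [← hqp] at h1
    simp only [entDiff, push_push] at h1 ⊢
    linarith
  · rw [I2_sub_I2_eq₂]
    rw [← hqp] at h2
    simp only [entDiff, push_push, id] at h2 ⊢
    linarith

end Converse

/-- **Theorem 1 (soft covering with side information).**
A pair `(R,C)` of nonnegative reals is achievable iff there is an auxiliary alphabet `𝒲`
with `|𝒲| ≤ (|𝒳||𝒴||𝒵|)²` and a joint PMF `q` on `𝒲 × (𝒳 × 𝒴 × 𝒵)` whose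
`𝒳 × 𝒴 × 𝒵`-marginal is `p`, such that `Z − X − W` and `X − (Z,W) − Y` are Markov chains,
`R ≥ I(X;W) − I(W;Z)` and `R + C ≥ I(X,Y,Z;W) − I(W;Z)`. -/
theorem statement0 {X Y Z : Type} [Fintype X] [Fintype Y] [Fintype Z]
    (p : X × Y × Z → ℝ) (hp : IsPMF p) (R C : ℝ) (hR : 0 ≤ R) (hC : 0 ≤ C) :
    RsAchievable p R C ↔
      ∃ k : ℕ, k ≤ (Fintype.card X * Fintype.card Y * Fintype.card Z) ^ 2 ∧
        ∃ q : Fin k × (X × Y × Z) → ℝ,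
          IsPMF q ∧
          (∀ v : X × Y × Z, push q Prod.snd v = p v) ∧
          Markov (push q (fun u => (u.2.2.2, u.2.1, u.1))) ∧
          Markov (push q (fun u => (u.2.1, (u.2.2.2, u.1), u.2.2.1))) ∧
          I2 (push q (fun u => (u.2.1, u.1))) - I2 (push q (fun u => (u.1, u.2.2.2))) ≤ R ∧
          I2 (push q (fun u => (u.2, u.1))) - I2 (push q (fun u => (u.1, u.2.2.2))) ≤ R + C := by
  exact ⟨fun h => ⟨_, le_rfl, exists_auxiliary_of_rsAchievable hp hC h⟩,
    fun ⟨_, _, _, hq, hqp, hm₁, hm₂, h₁, h₂⟩ =>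
      rsAchievable_of_auxiliary hR hq hqp hm₁ hm₂ h₁ h₂⟩
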